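/- arXiv:1311.1994 — 2 statements merged into one kernel-verified Lean document; each statement's English description precedes it below -/
import Mathlib

section
/- The graph obtained from the complete graph K₆ by deleting one edge is not NIC-planar; and for any two distinct edges e₁ and e₂ of K₆, the graph obtained from K₆ by deleting both e₁ and e₂ is IC-planar (and hence NIC-planar). -/
open Set

/-- Two subsets of the plane *properly cross* at a point `p`: in some open
neighbourhood of `p` the pair of sets looks, up to homeomorphism, like the two
coordinate axes meeting at the origin. -/
def ProperCross (A₁ A₂ : Set (ℝ × ℝ)) (p : ℝ × ℝ) : Prop :=
  ∃ U : Set (ℝ × ℝ), IsOpen U ∧ ∃ hp : p ∈ U, ∃ φ : U ≃ₜ (ℝ × ℝ),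
    φ ⟨p, hp⟩ = (0, 0) ∧
    (fun x => φ x) '' {x : U | (x : ℝ × ℝ) ∈ A₁} = {q : ℝ × ℝ | q.2 = 0} ∧
    (fun x => φ x) '' {x : U | (x : ℝ × ℝ) ∈ A₂} = {q : ℝ × ℝ | q.1 = 0}

/-- A drawing of a simple graph `G` in the plane: vertices go to distinct points,
each edge is drawn as a continuous injective arc joining the points of its two
endpoints, no arc passes through the point of a vertex other than its endpoints,
arcs of edges sharing an endpoint meet only at that common point, any two arcs
meet in finitely many points, every intersection point of two arcs that is not a
common endpoint is a proper crossing, and no point of the plane that is not a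
vertex point lies on more than two arcs. -/
structure Drawing {V : Type*} (G : SimpleGraph V) where
  pos : V → ℝ × ℝ
  pos_inj : Function.Injective pos
  arc : G.edgeSet → ℝ → ℝ × ℝ
  arc_cont : ∀ e, ContinuousOn (arc e) (Icc 0 1)
  arc_inj : ∀ e, InjOn (arc e) (Icc 0 1)
  arc_ends : ∀ e : G.edgeSet, ∃ u v : V, (e : Sym2 V) = s(u, v) ∧
    arc e 0 = pos u ∧ arc e 1 = pos v
  no_vertex_interior : ∀ (e : G.edgeSet) (v : V), v ∉ (e : Sym2 V) →
    pos v ∉ arc e '' Icc 0 1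
  shared_endpoint : ∀ e₁ e₂ : G.edgeSet, e₁ ≠ e₂ → ∀ v : V,
    v ∈ (e₁ : Sym2 V) → v ∈ (e₂ : Sym2 V) →
    arc e₁ '' Icc 0 1 ∩ arc e₂ '' Icc 0 1 ⊆ {pos v}
  finite_meet : ∀ e₁ e₂ : G.edgeSet, e₁ ≠ e₂ →
    (arc e₁ '' Icc 0 1 ∩ arc e₂ '' Icc 0 1).Finite
  proper : ∀ e₁ e₂ : G.edgeSet, e₁ ≠ e₂ →
    ∀ p ∈ arc e₁ '' Icc 0 1 ∩ arc e₂ '' Icc 0 1, p ∉ Set.range pos →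
    ProperCross (arc e₁ '' Icc 0 1) (arc e₂ '' Icc 0 1) p
  at_most_two : ∀ p : ℝ × ℝ, p ∉ Set.range pos →
    ∀ e₁ e₂ e₃ : G.edgeSet, p ∈ arc e₁ '' Icc 0 1 → p ∈ arc e₂ '' Icc 0 1 →
      p ∈ arc e₃ '' Icc 0 1 → e₁ = e₂ ∨ e₁ = e₃ ∨ e₂ = e₃

namespace Drawing

variable {V : Type*} {G : SimpleGraph V}

/-- The image of the arc drawn for the edge `e`. -/
def arcIm (D : Drawing G) (e : G.edgeSet) : Set (ℝ × ℝ) :=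
  D.arc e '' Icc 0 1

/-- The set of crossings of the drawing: points that are not vertex points and
lie on (at least, hence exactly) two arcs.  (An intersection point of two arcs
that is a common endpoint of the two edges is a vertex point, and conversely a
vertex point on two arcs is a common endpoint, so these are precisely the
intersection points of pairs of arcs that are not common endpoints.) -/
def crossings (D : Drawing G) : Set (ℝ × ℝ) :=
  {p | p ∉ Set.range D.pos ∧ ∃ e₁ e₂ : G.edgeSet, e₁ ≠ e₂ ∧ p ∈ D.arcIm e₁ ∧ p ∈ D.arcIm e₂}

/-- The number of crossings of the drawing. -/
noncomputable def crossingCount (D : Drawing G) : ℕ := D.crossings.ncard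

/-- The cluster set `S(c)` of a crossing `c`: the set of end-vertices of the
(two) edges whose arcs pass through `c`. -/
def cluster (D : Drawing G) (c : ℝ × ℝ) : Set V :=
  {v | ∃ e : G.edgeSet, c ∈ D.arcIm e ∧ v ∈ (e : Sym2 V)}

/-- A drawing is 1-planar if each edge's arc is crossed at most once. -/
def IsOnePlanar (D : Drawing G) : Prop :=
  ∀ e : G.edgeSet, {p | p ∈ D.crossings ∧ p ∈ D.arcIm e}.Subsingleton

/-- A drawing is NIC-planar if it is 1-planar and the cluster sets of any two
distinct crossings share at most one vertex. -/
def IsNICPlanar (D : Drawing G) : Prop :=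
  D.IsOnePlanar ∧ ∀ c₁ ∈ D.crossings, ∀ c₂ ∈ D.crossings, c₁ ≠ c₂ →
    (D.cluster c₁ ∩ D.cluster c₂).ncard ≤ 1

/-- A drawing is IC-planar if it is 1-planar and the cluster sets of any two
distinct crossings are disjoint. -/
def IsICPlanar (D : Drawing G) : Prop :=
  D.IsOnePlanar ∧ ∀ c₁ ∈ D.crossings, ∀ c₂ ∈ D.crossings, c₁ ≠ c₂ →
    D.cluster c₁ ∩ D.cluster c₂ = ∅

end Drawing

/-- A graph is 1-planar if it admits a 1-planar drawing. -/
def SimpleGraph.OnePlanar {V : Type*} (G : SimpleGraph V) : Prop :=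
  ∃ D : Drawing G, D.IsOnePlanar

/-- A graph is NIC-planar if it admits an NIC-planar drawing. -/
def SimpleGraph.NICPlanar {V : Type*} (G : SimpleGraph V) : Prop :=
  ∃ D : Drawing G, D.IsNICPlanar

/-- A graph is IC-planar if it admits an IC-planar drawing. -/
def SimpleGraph.ICPlanar {V : Type*} (G : SimpleGraph V) : Prop :=
  ∃ D : Drawing G, D.IsICPlanar

/-- The crossing number of `G`: the minimum number of crossings over all
drawings of `G`. -/
noncomputable def SimpleGraph.crossingNumber {V : Type*} (G : SimpleGraph V) : ℕ :=
  sInf {n | ∃ D : Drawing G, D.crossingCount = n}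
/-- The graph `H` is a minimum non-NIC-planar graph: `H` is not NIC-planar but
deleting any single edge of `H` yields an NIC-planar graph. -/
def MinNonNICPlanar {V : Type*} (H : SimpleGraph V) : Prop :=
  ¬ H.NICPlanar ∧ ∀ e ∈ H.edgeSet, (H.deleteEdges {e}).NICPlanar

/-- The graph `H` is a minimum non-IC-planar graph: `H` is not IC-planar but
deleting any single edge of `H` yields an IC-planar graph. -/
def MinNonICPlanar {V : Type*} (H : SimpleGraph V) : Prop :=
  ¬ H.ICPlanar ∧ ∀ e ∈ H.edgeSet, (H.deleteEdges {e}).ICPlanar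

/-- The complete multipartite graph with parts of sizes `a 0, …, a (k-1)`. -/
abbrev completeMultipartite {k : ℕ} (a : Fin k → ℕ) :
    SimpleGraph (Σ i : Fin k, Fin (a i)) :=
  SimpleGraph.completeMultipartiteGraph fun i => Fin (a i)

/-- `G` contains a subgraph isomorphic to `H`, i.e. there is an injective graph
homomorphism from `H` to `G`. -/
def ContainsSubgraphIso {V W : Type*} (G : SimpleGraph V) (H : SimpleGraph W) : Prop :=
  ∃ f : H →g G, Function.Injective f

/-- A nowhere vanishing continuous function on the plane has a continuous logarithm. -/
theorem exists_continuous_log {f : ℝ × ℝ → ℂ} (hf : Continuous f) (h0 : ∀ x, f x ≠ 0) :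
    ∃ G : ℝ × ℝ → ℂ, Continuous G ∧ ∀ x, Complex.exp (G x) = f x := by
  obtain ⟨G, ⟨-, hG⟩, -⟩ := Complex.isCoveringMapOn_exp.existsUnique_continuousMap_lifts
    (A := ℝ × ℝ) ⟨f, hf⟩ (a₀ := 0) (Complex.exp_log (h0 0)) h0
  exact ⟨G, G.continuous, fun x => congrFun hG x⟩

/-- Two continuous logarithms of the same function differ by a constant. -/
theorem log_increment_eq {g h : ℝ → ℂ} (hg : Continuous g) (hh : Continuous h)
    (e : ∀ t, Complex.exp (g t) = Complex.exp (h t)) : g 1 - g 0 = h 1 - h 0 := by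
  have key : g = fun t => h t + (g 0 - h 0) := by
    refine Complex.isCoveringMap_exp.eq_of_comp_eq hg (by fun_prop) ?_ 0
      (add_sub_cancel (h 0) (g 0)).symm
    funext t
    apply Subtype.ext
    change Complex.exp (g t) = Complex.exp (h t + (g 0 - h 0))
    simp [Complex.exp_add, Complex.exp_sub, e]
  have := congrFun key 1
  rw [this]; ring

theorem log_increment_eq_of_neg {g h : ℝ → ℂ} (hg : Continuous g) (hh : Continuous h)
    (e : ∀ t, Complex.exp (g t) = -Complex.exp (h t)) : g 1 - g 0 = h 1 - h 0 := by
  have := log_increment_eq hg (h := fun t => h t + Real.pi * Complex.I) (by fun_prop)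
    (fun t => by rw [e, Complex.exp_add, Complex.exp_pi_mul_I]; ring)
  rw [this]; ring

/-- The increment of a continuous logarithm of `±(γ - z)` along a path `γ` does not depend on the
logarithm, and is determined by the endpoints up to a multiple of `2πi`. -/
theorem exists_winding (γ : ℝ → ℂ) (z a b : ℂ) (ha : Complex.exp a = γ 0 - z)
    (hb : Complex.exp b = γ 1 - z) :
    ∃ n : ℤ, ∀ g : ℝ → ℂ, Continuous g →
      ((∀ t, Complex.exp (g t) = γ t - z) ∨ ∀ t, Complex.exp (g t) = z - γ t) →
      g 1 - g 0 = b - a + n * (2 * Real.pi * Complex.I) := by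
  by_cases hex : ∃ g : ℝ → ℂ, Continuous g ∧
      ((∀ t, Complex.exp (g t) = γ t - z) ∨ ∀ t, Complex.exp (g t) = z - γ t)
  · obtain ⟨h, hh, hh'⟩ := hex
    obtain ⟨n, hn⟩ : ∃ n : ℤ, h 1 - h 0 = b - a + n * (2 * Real.pi * Complex.I) := by
      apply Complex.exp_eq_exp_iff_exists_int.1
      rw [Complex.exp_sub, Complex.exp_sub, ha, hb]
      rcases hh' with hh' | hh' <;> rw [hh', hh']
      rw [← neg_sub, ← neg_sub (γ 0), neg_div_neg_eq]
    refine ⟨n, fun g hg hg' => ?_⟩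
    rw [← hn]
    rcases hh' with hh' | hh' <;> rcases hg' with hg' | hg'
    · exact log_increment_eq hg hh fun t => by rw [hg', hh']
    · exact log_increment_eq_of_neg hg hh fun t => by rw [hg', hh', neg_sub]
    · exact log_increment_eq_of_neg hg hh fun t => by rw [hg', hh', neg_sub]
    · exact log_increment_eq hg hh fun t => by rw [hg', hh']
  · exact ⟨0, fun g hg hg' => (hex ⟨g, hg, hg'⟩).elim⟩

/-- Logarithms of the differences of distinct points, antisymmetric up to `πi`. -/
theorem exists_log_sub {p : Fin 3 → ℂ} (hp : Function.Injective p) :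
    ∃ K : Fin 3 → Fin 3 → ℂ, (∀ i j, i ≠ j → Complex.exp (K i j) = p j - p i) ∧
      ∀ i j, i < j → K j i - K i j = Real.pi * Complex.I := by
  refine ⟨fun i j => if i < j then Complex.log (p j - p i)
    else Complex.log (p i - p j) + Real.pi * Complex.I, fun i j hij => ?_, fun i j hij => ?_⟩
  · have h1 : p j - p i ≠ 0 := sub_ne_zero.2 (hp.ne hij.symm)
    have h2 : p i - p j ≠ 0 := sub_ne_zero.2 (hp.ne hij)
    dsimp only
    split_ifs
    · exact Complex.exp_log h1
    · rw [Complex.exp_add, Complex.exp_log h2, Complex.exp_pi_mul_I]; ring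
  · simp [hij, hij.not_gt]

/-- `K₃,₃` cannot be mapped continuously to the plane so that non-adjacent edges have disjoint
images. -/
theorem not_disjoint_completeBipartite_three_three (p q : Fin 3 → ℂ) (γ : Fin 3 → Fin 3 → ℝ → ℂ)
    (hc : ∀ i j, Continuous (γ i j)) (h0 : ∀ i j, γ i j 0 = p i) (h1 : ∀ i j, γ i j 1 = q j)
    (hd : ∀ i i' j j', i ≠ i' → j ≠ j' → ∀ s t, γ i j s ≠ γ i' j' t) : False := by
  have hp : Function.Injective p := fun i i' h => by
    by_contra hne
    exact hd i i' 0 1 hne (by decide) 0 0 (by rw [h0, h0, h])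
  have hq : Function.Injective q := fun j j' h => by
    by_contra hne
    exact hd 0 1 j j' (by decide) hne 1 1 (by rw [h1, h1, h])
  have hpq : ∀ i j, q j - p i ≠ 0 := fun i j h => by
    obtain ⟨i', hi⟩ := exists_ne i
    obtain ⟨j', hj⟩ := exists_ne j
    exact hd i' i j j' hi hj.symm 1 0 (by rw [h0, h1]; exact sub_eq_zero.1 h)
  obtain ⟨K, hK, hK'⟩ := exists_log_sub hp
  obtain ⟨L, hL, hL'⟩ := exists_log_sub hq
  set M : Fin 3 → Fin 3 → ℂ := fun i j => Complex.log (q j - p i)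
  have hM : ∀ i j, Complex.exp (M i j) = q j - p i := fun i j => Complex.exp_log (hpq i j)
  have hn : ∀ i i' j', ∃ n : ℤ, i ≠ i' → ∀ g : ℝ → ℂ, Continuous g →
      ((∀ t, Complex.exp (g t) = γ i' j' t - p i) ∨ ∀ t, Complex.exp (g t) = p i - γ i' j' t) →
      g 1 - g 0 = M i j' - K i i' + n * (2 * Real.pi * Complex.I) := fun i i' j' => by
    by_cases h : i = i'
    · exact ⟨0, fun h' => (h' h).elim⟩
    · obtain ⟨n, hn⟩ := exists_winding (γ i' j') (p i) (K i i') (M i j')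
        (by rw [hK _ _ h, h0]) (by rw [hM, h1])
      exact ⟨n, fun _ => hn⟩
  have hm : ∀ j i' j', ∃ m : ℤ, j ≠ j' → ∀ g : ℝ → ℂ, Continuous g →
      ((∀ t, Complex.exp (g t) = γ i' j' t - q j) ∨ ∀ t, Complex.exp (g t) = q j - γ i' j' t) →
      g 1 - g 0 = L j j' - (M i' j + Real.pi * Complex.I) + m * (2 * Real.pi * Complex.I) :=
    fun j i' j' => by
    by_cases h : j = j'
    · exact ⟨0, fun h' => (h' h).elim⟩
    · obtain ⟨n, hn⟩ := exists_winding (γ i' j') (q j) (M i' j + Real.pi * Complex.I) (L j j')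
        (by rw [Complex.exp_add, hM, h0, Complex.exp_pi_mul_I]; ring) (by rw [hL _ _ h, h1])
      exact ⟨n, fun _ => hn⟩
  choose n hn using hn
  choose m hm using hm
  have square : ∀ i i' j j', i ≠ i' → j ≠ j' →
      (K i' i - K i i') + (L j' j - L j j') +
        ((n i i' j' + m j' i j - m j i' j' - n i' i j : ℤ) : ℂ) * (2 * Real.pi * Complex.I) = 0 := by
    intro i i' j j' hi hj
    obtain ⟨G, hGc, hG⟩ := exists_continuous_log (f := fun x => γ i' j' x.2 - γ i j x.1)
      (by have := hc i j; have := hc i' j'; fun_prop)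
      (fun x => sub_ne_zero.2 (hd i i' j j' hi hj x.1 x.2).symm)
    have e1 := hn i i' j' hi (fun t => G (0, t)) (by fun_prop)
      (Or.inl fun t => by rw [hG, h0])
    have e2 := hm j i' j' hj (fun t => G (1, t)) (by fun_prop)
      (Or.inl fun t => by rw [hG, h1])
    have e3 := hn i' i j hi.symm (fun t => G (t, 0)) (by fun_prop)
      (Or.inr fun t => by rw [hG, h0])
    have e4 := hm j' i j hj.symm (fun t => G (t, 1)) (by fun_prop)
      (Or.inr fun t => by rw [hG, h1])
    push_cast
    linear_combination e2 + e3 - e1 - e4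
  have hpi : (Real.pi * Complex.I : ℂ) ≠ 0 := by simp [Real.pi_ne_zero]
  have sq1 : ∀ i i' j j', i < i' → j < j' →
      n i i' j' + m j' i j - m j i' j' - n i' i j = -1 := by
    intro i i' j j' hi hj
    have := square i i' j j' hi.ne hj.ne
    rw [hK' i i' hi, hL' j j' hj] at this
    have h2 : ((n i i' j' + m j' i j - m j i' j' - n i' i j : ℤ) : ℂ) = ((-1 : ℤ) : ℂ) := by
      apply mul_right_cancel₀ (mul_ne_zero two_ne_zero hpi)
      push_cast at this ⊢
      linear_combination this
    exact_mod_cast h2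
  have sq2 : ∀ i i' j j', i < i' → j' < j →
      n i i' j' + m j' i j - m j i' j' - n i' i j = 0 := by
    intro i i' j j' hi hj
    have := square i i' j j' hi.ne hj.ne'
    rw [hK' i i' hi] at this
    have h3 := hL' j' j hj
    have h2 : ((n i i' j' + m j' i j - m j i' j' - n i' i j : ℤ) : ℂ) = ((0 : ℤ) : ℂ) := by
      apply mul_right_cancel₀ (mul_ne_zero two_ne_zero hpi)
      push_cast at this ⊢
      linear_combination this + h3
    exact_mod_cast h2
  have a01 : (0 : Fin 3) < 1 := by decide
  have a02 : (0 : Fin 3) < 2 := by decide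
  have a12 : (1 : Fin 3) < 2 := by decide
  have := sq1 0 1 0 1 a01 a01
  have := sq1 0 1 0 2 a01 a02
  have := sq1 0 1 1 2 a01 a12
  have := sq1 0 2 0 1 a02 a01
  have := sq1 0 2 0 2 a02 a02
  have := sq1 0 2 1 2 a02 a12
  have := sq1 1 2 0 1 a12 a01
  have := sq1 1 2 0 2 a12 a02
  have := sq1 1 2 1 2 a12 a12
  have := sq2 0 1 1 0 a01 a01
  have := sq2 0 1 2 0 a01 a02
  have := sq2 0 1 2 1 a01 a12
  have := sq2 0 2 1 0 a02 a01
  have := sq2 0 2 2 0 a02 a02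
  have := sq2 0 2 2 1 a02 a12
  have := sq2 1 2 1 0 a12 a01
  have := sq2 1 2 2 0 a12 a02
  have := sq2 1 2 2 1 a12 a12
  omega

namespace Drawing

variable {V : Type*} {G : SimpleGraph V}

/-- The arc of an edge can be parametrised by the whole line, starting at a prescribed end. -/
theorem exists_path (D : Drawing G) {u v : V} (h : G.Adj u v) :
    ∃ γ : ℝ → ℝ × ℝ, Continuous γ ∧ γ 0 = D.pos u ∧ γ 1 = D.pos v ∧
      ∀ t, γ t ∈ D.arcIm ⟨s(u, v), h⟩ := by
  set e : G.edgeSet := ⟨s(u, v), h⟩ with he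
  have hcont : Continuous (IccExtend (zero_le_one' ℝ) (fun t : Icc (0 : ℝ) 1 => D.arc e t)) :=
    (continuousOn_iff_continuous_domRestrict.1 (D.arc_cont e)).Icc_extend'
  have hmem : ∀ t, IccExtend (zero_le_one' ℝ) (fun t : Icc (0 : ℝ) 1 => D.arc e t) t ∈ D.arcIm e :=
    fun t => ⟨_, (projIcc (0 : ℝ) 1 zero_le_one t).2, rfl⟩
  have h0 : IccExtend (zero_le_one' ℝ) (fun t : Icc (0 : ℝ) 1 => D.arc e t) 0 = D.arc e 0 := by
    simp [IccExtend]
  have h1 : IccExtend (zero_le_one' ℝ) (fun t : Icc (0 : ℝ) 1 => D.arc e t) 1 = D.arc e 1 := by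
    simp [IccExtend]
  obtain ⟨a, b, hab, ha, hb⟩ := D.arc_ends e
  rcases Sym2.eq_iff.1 hab with ⟨rfl, rfl⟩ | ⟨rfl, rfl⟩
  · exact ⟨_, hcont, h0.trans ha, h1.trans hb, hmem⟩
  · refine ⟨fun t => IccExtend (zero_le_one' ℝ) (fun t : Icc (0 : ℝ) 1 => D.arc e t) (1 - t),
      by fun_prop, ?_, ?_, fun t => hmem _⟩
    · simp only [sub_zero]; exact h1.trans hb
    · simp only [sub_self]; exact h0.trans ha

theorem mem_of_pos_mem_arcIm (D : Drawing G) {e : G.edgeSet} {v : V} (h : D.pos v ∈ D.arcIm e) :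
    v ∈ (e : Sym2 V) :=
  by_contra fun hv => D.no_vertex_interior e v hv h

/-- In a drawing, `K₃,₃` contains two non-adjacent edges which cross. -/
theorem exists_crossing_of_completeBipartite (D : Drawing G) (A B : Fin 3 → V)
    (hA : Function.Injective A) (hB : Function.Injective B) (hAB : ∀ i j, A i ≠ B j)
    (hadj : ∀ i j, G.Adj (A i) (B j)) :
    ∃ i i' j j', i ≠ i' ∧ ∃ p ∈ D.crossings,
      p ∈ D.arcIm ⟨s(A i, B j), hadj i j⟩ ∧ p ∈ D.arcIm ⟨s(A i', B j'), hadj i' j'⟩ := by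
  choose γ hc h0 h1 hmem using fun i j => D.exists_path (hadj i j)
  by_contra! hno
  let φ := Complex.equivRealProdCLM.symm
  refine not_disjoint_completeBipartite_three_three (fun i => φ (D.pos (A i)))
    (fun j => φ (D.pos (B j))) (fun i j t => φ (γ i j t))
    (fun i j => φ.continuous.comp (hc i j)) (fun i j => by simp only [h0])
    (fun i j => by simp only [h1]) fun i i' j j' hi hj s t hst => ?_
  have hst := φ.injective hst
  have m1 := hmem i j s
  have m2 := hmem i' j' t
  rw [← hst] at m2
  refine hno i i' j j' hi _ ⟨?_, _, _, ?_, m1, m2⟩ m1 m2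
  · rintro ⟨v, hv⟩
    have v1 := D.mem_of_pos_mem_arcIm (hv ▸ m1)
    have v2 := D.mem_of_pos_mem_arcIm (hv ▸ m2)
    simp only [Sym2.mem_iff] at v1 v2
    rcases v1 with rfl | rfl <;> rcases v2 with v2 | v2
    · exact hi (hA v2)
    · exact hAB _ _ v2
    · exact hAB _ _ v2.symm
    · exact hj (hB v2)
  · intro h
    rcases Sym2.eq_iff.1 (Subtype.ext_iff.1 h) with h | h
    · exact hi (hA h.1)
    · exact hAB _ _ h.1

theorem four_le_ncard_cluster [Finite V] (D : Drawing G) {c : ℝ × ℝ} (hc : c ∈ D.crossings) :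
    4 ≤ (D.cluster c).ncard := by
  classical
  obtain ⟨hv, e₁, e₂, hne, h1, h2⟩ := hc
  have hdis : ∀ v, v ∈ (e₁ : Sym2 V) → v ∉ (e₂ : Sym2 V) := fun v hv1 hv2 =>
    hv ⟨v, (D.shared_endpoint e₁ e₂ hne v hv1 hv2 ⟨h1, h2⟩).symm⟩
  obtain ⟨⟨a, b⟩, hab⟩ := e₁
  obtain ⟨⟨x, y⟩, hxy⟩ := e₂
  have hab' : a ≠ b := G.ne_of_adj hab
  have hxy' : x ≠ y := G.ne_of_adj hxy
  have ha := hdis a (Sym2.mem_mk_left a b)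
  have hb := hdis b (Sym2.mem_mk_right a b)
  simp only [Sym2.mem_iff, not_or] at ha hb
  have hsub : (({a, b, x, y} : Finset V) : Set V) ⊆ D.cluster c := by
    intro v hv
    simp only [Finset.coe_insert, Finset.coe_singleton, mem_insert_iff, mem_singleton_iff] at hv
    rcases hv with rfl | rfl | rfl | rfl
    · exact ⟨_, h1, Sym2.mem_mk_left _ _⟩
    · exact ⟨_, h1, Sym2.mem_mk_right _ _⟩
    · exact ⟨_, h2, Sym2.mem_mk_left _ _⟩
    · exact ⟨_, h2, Sym2.mem_mk_right _ _⟩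
  have hcard : ({a, b, x, y} : Finset V).card = 4 := by
    rw [Finset.card_insert_of_notMem, Finset.card_insert_of_notMem, Finset.card_pair hxy'] <;>
      simp [hab', ha, hb]
  rw [← hcard, ← Set.ncard_coe_finset]
  exact Set.ncard_le_ncard hsub (Set.toFinite _)

/-- An NIC-planar drawing on six vertices has at most one crossing. -/
theorem IsNICPlanar.subsingleton_crossings {G : SimpleGraph (Fin 6)} {D : Drawing G}
    (hD : D.IsNICPlanar) : D.crossings.Subsingleton := by
  intro c₁ h1 c₂ h2
  by_contra hne
  have hi := hD.2 c₁ h1 c₂ h2 hne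
  have := Set.ncard_union_add_ncard_inter (D.cluster c₁) (D.cluster c₂)
  have h4 := D.four_le_ncard_cluster h1
  have h4' := D.four_le_ncard_cluster h2
  have h6 : (D.cluster c₁ ∪ D.cluster c₂).ncard ≤ 6 := by
    simpa using Set.ncard_le_card (D.cluster c₁ ∪ D.cluster c₂)
  omega

end Drawing

theorem exists_finset_of_two_edges : ∀ a b c d : Fin 6, ∃ S ∈ ({{0, 1, 2}, {0, 1, 3}, {0, 1, 4},
    {0, 1, 5}, {0, 2, 3}, {0, 2, 4}, {0, 2, 5}, {0, 3, 4}, {0, 3, 5}, {0, 4, 5}} :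
      Finset (Finset (Fin 6))), (a ∈ S ↔ b ∈ S) ∧ (c ∈ S ↔ d ∈ S) := by
  decide

/-- `K₆` minus any two edges contains `K₃,₃`. -/
theorem exists_completeBipartite_avoiding (e f : Sym2 (Fin 6)) :
    ∃ A B : Fin 3 → Fin 6, Function.Injective A ∧ Function.Injective B ∧ (∀ i j, A i ≠ B j) ∧
      (∀ i j, s(A i, B j) ≠ e) ∧ ∀ i j, s(A i, B j) ≠ f := by
  induction e with | _ a b
  induction f with | _ c d
  obtain ⟨S, hS, hab, hcd⟩ := exists_finset_of_two_edges a b c d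
  have hcard : S.card = 3 := by clear hab hcd; revert S; decide
  have hcard' : Sᶜ.card = 3 := by rw [Finset.card_compl, hcard]; rfl
  have hA := S.orderEmbOfFin_mem hcard
  have hB := fun j => Finset.mem_compl.1 (Sᶜ.orderEmbOfFin_mem hcard' j)
  refine ⟨S.orderEmbOfFin hcard, Sᶜ.orderEmbOfFin hcard', (S.orderEmbOfFin hcard).injective,
    (Sᶜ.orderEmbOfFin hcard').injective, fun i j h => hB j (h ▸ hA i), fun i j h => ?_,
    fun i j h => ?_⟩
  · have h1 := hA i
    have h2 := hB j
    rcases Sym2.eq_iff.1 h with ⟨h, h'⟩ | ⟨h, h'⟩ <;> rw [h] at h1 <;> rw [h'] at h2 <;> tauto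
  · have h1 := hA i
    have h2 := hB j
    rcases Sym2.eq_iff.1 h with ⟨h, h'⟩ | ⟨h, h'⟩ <;> rw [h] at h1 <;> rw [h'] at h2 <;> tauto

theorem not_nicPlanar_top_deleteEdges_singleton (e : Sym2 (Fin 6)) :
    ¬ ((⊤ : SimpleGraph (Fin 6)).deleteEdges {e}).NICPlanar := by
  rintro ⟨D, hD⟩
  obtain ⟨f, hf⟩ : ∃ f : Sym2 (Fin 6), ∀ p ∈ D.crossings, ∀ g₁ g₂, p ∈ D.arcIm g₁ →
      p ∈ D.arcIm g₂ → (g₁ : Sym2 (Fin 6)) ≠ f → (g₂ : Sym2 (Fin 6)) ≠ f → g₁ = g₂ := by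
    rcases D.crossings.eq_empty_or_nonempty with h | ⟨c, hc⟩
    · exact ⟨e, fun p hp => by simp [h] at hp⟩
    · obtain ⟨hcv, e₁, -, -, h1, -⟩ := id hc
      refine ⟨e₁, fun p hp g₁ g₂ hg1 hg2 hne1 hne2 => ?_⟩
      obtain rfl := hD.subsingleton_crossings hp hc
      rcases D.at_most_two p hcv e₁ g₁ g₂ h1 hg1 hg2 with h | h | h
      · exact (hne1 (by rw [h])).elim
      · exact (hne2 (by rw [h])).elim
      · exact h
  obtain ⟨A, B, hA, hB, hAB, he, hf'⟩ := exists_completeBipartite_avoiding e f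
  have hadj : ∀ i j, ((⊤ : SimpleGraph (Fin 6)).deleteEdges {e}).Adj (A i) (B j) := fun i j => by
    simp [SimpleGraph.deleteEdges_adj, hAB, he]
  obtain ⟨i, i', j, j', hi, p, hp, h1, h2⟩ :=
    D.exists_crossing_of_completeBipartite A B hA hB hAB hadj
  rcases Sym2.eq_iff.1 (Subtype.ext_iff.1 (hf p hp _ _ h1 h2 (hf' i j) (hf' i' j'))) with h | h
  · exact hi (hA h.1)
  · exact hAB _ _ h.1

/-- Twice the signed area of the triangle `abc`. -/
def orient {R : Type*} [CommRing R] (a b c : R × R) : R :=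
  (b.1 - a.1) * (c.2 - a.2) - (b.2 - a.2) * (c.1 - a.1)

theorem orient_map_intCast (a b c : ℤ × ℤ) :
    orient (a.map Int.cast Int.cast) (b.map Int.cast Int.cast) (c.map Int.cast Int.cast) =
      ((orient a b c : ℤ) : ℝ) := by
  simp [orient]

theorem orient_lineMap (a b c d : ℝ × ℝ) (t : ℝ) :
    orient a b (AffineMap.lineMap c d t) = (1 - t) * orient a b c + t * orient a b d := by
  simp [orient, AffineMap.lineMap_apply]; ring

theorem orient_eq_zero_of_mem_segment {a b p : ℝ × ℝ} (h : p ∈ segment ℝ a b) :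
    orient a b p = 0 := by
  rw [segment_eq_image_lineMap] at h
  obtain ⟨t, -, rfl⟩ := h
  rw [orient_lineMap]; simp only [orient]; ring

/-- Coordinates in which the lines `ab` and `cd` are parallel to the axes. -/
theorem eq_of_orient_eq {a b c d p q : ℝ × ℝ} (h : orient a b c ≠ orient a b d)
    (h1 : orient a b p = orient a b q) (h2 : orient c d p = orient c d q) : p = q := by
  have hD : orient a b c - orient a b d ≠ 0 := sub_ne_zero.2 h
  ext
  · apply mul_left_cancel₀ hD
    simp only [orient] at *
    linear_combination (c.1 - d.1) * h1 + (b.1 - a.1) * h2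
  · apply mul_left_cancel₀ hD
    simp only [orient] at *
    linear_combination (c.2 - d.2) * h1 + (b.2 - a.2) * h2

/-- Segments on one side of each other do not meet. -/
theorem disjoint_segment_of_orient {a b c d : ℝ × ℝ} (h : 0 < orient a b c * orient a b d) :
    Disjoint (segment ℝ a b) (segment ℝ c d) := by
  rw [Set.disjoint_left]
  intro p hp hp'
  have h0 := orient_eq_zero_of_mem_segment hp
  rw [segment_eq_image_lineMap] at hp'
  obtain ⟨t, ⟨ht0, ht1⟩, rfl⟩ := hp'
  rw [orient_lineMap] at h0
  have hX : 0 < orient a b c ^ 2 := by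
    have : orient a b c ≠ 0 := left_ne_zero_of_mul h.ne'
    positivity
  have hsum : (1 - t) * orient a b c ^ 2 + t * (orient a b c * orient a b d) = 0 := by
    linear_combination orient a b c * h0
  rcases ht0.eq_or_lt with rfl | ht
  · linarith
  · have := mul_pos ht h
    have := mul_nonneg (sub_nonneg.2 ht1) hX.le
    linarith

theorem mem_segment_of_orient {a b c d q : ℝ × ℝ} (h : orient c d a * orient c d b < 0)
    (h0 : orient a b q = 0) (ha : |orient c d q| ≤ |orient c d a|)
    (hb : |orient c d q| ≤ |orient c d b|) : q ∈ segment ℝ a b := by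
  have hne : orient c d a ≠ orient c d b := fun h' => by
    rw [h'] at h; exact (mul_self_nonneg _).not_gt h
  have hne' : orient c d b - orient c d a ≠ 0 := sub_ne_zero.2 hne.symm
  set t := (orient c d q - orient c d a) / (orient c d b - orient c d a) with ht
  have hq : AffineMap.lineMap a b t = q := by
    apply eq_of_orient_eq hne
    · rw [orient_lineMap, ht]; field_simp; ring
    · rw [orient_lineMap, h0]; simp only [orient]; ring
  have hab := mul_neg_iff.1 h
  rw [segment_eq_image_lineMap]
  refine ⟨t, ?_, hq⟩
  rcases hab with ⟨h1, h2⟩ | ⟨h1, h2⟩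
  · rw [abs_of_pos h1] at ha
    rw [abs_of_neg h2] at hb
    have := abs_le.1 ha
    have := abs_le.1 hb
    exact ⟨div_nonneg_of_nonpos (by linarith) (by linarith),
      (div_le_one_of_neg (by linarith)).2 (by linarith)⟩
  · rw [abs_of_neg h1] at ha
    rw [abs_of_pos h2] at hb
    have := abs_le.1 ha
    have := abs_le.1 hb
    exact ⟨div_nonneg (by linarith) (by linarith), (div_le_one (by linarith)).2 (by linarith)⟩

/-- The coordinates `(orient c d q / δ, orient a b q / δ)` near an intersection point of two
lines `ab` and `cd`. -/
noncomputable def crossHomeomorph {a b c d p : ℝ × ℝ} {δ : ℝ} (hδ : δ ≠ 0)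
    (hne : orient a b c ≠ orient a b d) (h1 : orient c d p = 0) (h2 : orient a b p = 0) :
    (ℝ × ℝ) ≃ₜ (ℝ × ℝ) where
  toFun q := (orient c d q / δ, orient a b q / δ)
  invFun x := p + (δ / (orient a b c - orient a b d)) •
    (x.1 • (b - a) - x.2 • (d - c))
  left_inv q := by
    apply eq_of_orient_eq hne
    · have hD : orient a b c - orient a b d ≠ 0 := sub_ne_zero.2 hne
      have : orient a b (p + (δ / (orient a b c - orient a b d)) •
          ((orient c d q / δ) • (b - a) - (orient a b q / δ) • (d - c))) =
          orient a b p + (orient a b q / δ) * (δ / (orient a b c - orient a b d)) *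
            (orient a b c - orient a b d) := by
        simp [orient]; ring
      rw [this, h2]
      field_simp
      ring
    · have hD : orient a b c - orient a b d ≠ 0 := sub_ne_zero.2 hne
      have : orient c d (p + (δ / (orient a b c - orient a b d)) •
          ((orient c d q / δ) • (b - a) - (orient a b q / δ) • (d - c))) =
          orient c d p + (orient c d q / δ) * (δ / (orient a b c - orient a b d)) *
            (orient a b c - orient a b d) := by
        simp [orient]; ring
      rw [this, h1]
      field_simp
      ring
  right_inv x := by
    have hD : orient a b c - orient a b d ≠ 0 := sub_ne_zero.2 hne
    have e1 : orient c d (p + (δ / (orient a b c - orient a b d)) •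
          (x.1 • (b - a) - x.2 • (d - c))) =
          orient c d p + x.1 * (δ / (orient a b c - orient a b d)) *
            (orient a b c - orient a b d) := by
      simp [orient]; ring
    have e2 : orient a b (p + (δ / (orient a b c - orient a b d)) •
          (x.1 • (b - a) - x.2 • (d - c))) =
          orient a b p + x.2 * (δ / (orient a b c - orient a b d)) *
            (orient a b c - orient a b d) := by
      simp [orient]; ring
    dsimp only
    rw [e1, e2, h1, h2]
    ext <;> simp <;> field_simp
  continuous_toFun := by unfold orient; fun_prop
  continuous_invFun := by fun_prop

theorem Homeomorph.unitBall_symm_eq_smul {E : Type*} [SeminormedAddCommGroup E] [NormedSpace ℝ E]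
    (y : Metric.ball (0 : E) 1) :
    ∃ k : ℝ, k ≠ 0 ∧ (Homeomorph.unitBall.symm y : E) = k • (y : E) := by
  refine ⟨_, ?_, Homeomorph.unitBall_symm_apply y⟩
  have := mem_ball_zero_iff.1 y.2
  have : 0 < 1 - ‖(y : E)‖ ^ 2 := by nlinarith [norm_nonneg (y : E)]
  positivity

theorem properCross_segment {a b c d p : ℝ × ℝ} (h1 : orient a b c * orient a b d < 0)
    (h2 : orient c d a * orient c d b < 0) (hp : p ∈ segment ℝ a b) (hp' : p ∈ segment ℝ c d) :
    ProperCross (segment ℝ a b) (segment ℝ c d) p := by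
  have hne : orient a b c ≠ orient a b d := fun h' => by
    rw [h'] at h1; exact (mul_self_nonneg _).not_gt h1
  have hc := abs_pos.2 (left_ne_zero_of_mul h1.ne)
  have hd := abs_pos.2 (right_ne_zero_of_mul h1.ne)
  have ha := abs_pos.2 (left_ne_zero_of_mul h2.ne)
  have hb := abs_pos.2 (right_ne_zero_of_mul h2.ne)
  obtain ⟨δ, hδ, hδ'⟩ := exists_between (lt_min (lt_min hc hd) (lt_min ha hb))
  simp only [lt_inf_iff] at hδ'
  have p1 := orient_eq_zero_of_mem_segment hp
  have p2 := orient_eq_zero_of_mem_segment hp'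
  let T := crossHomeomorph hδ.ne' hne p2 p1
  have hT : ∀ q, T q = (orient c d q / δ, orient a b q / δ) := fun q => rfl
  let φ : {q | T q ∈ Metric.ball (0 : ℝ × ℝ) 1} ≃ₜ (ℝ × ℝ) :=
    (T.subtype (q := fun x => x ∈ Metric.ball (0 : ℝ × ℝ) 1) fun _ => Iff.rfl).trans
      Homeomorph.unitBall.symm
  have hφ : ∀ x, ∃ k : ℝ, k ≠ 0 ∧ φ x = k • T x := fun x =>
    Homeomorph.unitBall_symm_eq_smul _
  have hTp : T p = 0 := by simp [hT, p1, p2]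
  have hpU : T p ∈ Metric.ball (0 : ℝ × ℝ) 1 := by simp [hTp]
  have hU : ∀ x : {q | T q ∈ Metric.ball (0 : ℝ × ℝ) 1},
      |orient c d x| < δ ∧ |orient a b x| < δ := fun x => by
    have := x.2
    simpa [hT, Prod.norm_def, abs_div, abs_of_pos hδ, div_lt_one hδ] using this
  refine ⟨_, Metric.isOpen_ball.preimage T.continuous, hpU, φ, ?_, ?_, ?_⟩
  · obtain ⟨k, -, h⟩ := hφ ⟨p, hpU⟩
    rw [h, hTp, smul_zero]; rfl
  · ext q
    constructor
    · rintro ⟨x, hx, rfl⟩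
      obtain ⟨k, -, h⟩ := hφ x
      simp [h, hT, orient_eq_zero_of_mem_segment hx]
    · intro hq
      refine ⟨φ.symm q, ?_, φ.apply_symm_apply q⟩
      obtain ⟨k, hk, h⟩ := hφ (φ.symm q)
      rw [φ.apply_symm_apply] at h
      have h0 : orient a b (φ.symm q) = 0 := by
        have := congrArg Prod.snd h
        rw [show q.2 = 0 from hq] at this
        simpa [hT, hk, hδ.ne'] using this.symm
      have := hU (φ.symm q)
      exact mem_segment_of_orient h2 h0 (by linarith) (by linarith)
  · ext q
    constructor
    · rintro ⟨x, hx, rfl⟩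
      obtain ⟨k, -, h⟩ := hφ x
      simp [h, hT, orient_eq_zero_of_mem_segment hx]
    · intro hq
      refine ⟨φ.symm q, ?_, φ.apply_symm_apply q⟩
      obtain ⟨k, hk, h⟩ := hφ (φ.symm q)
      rw [φ.apply_symm_apply] at h
      have h0 : orient c d (φ.symm q) = 0 := by
        have := congrArg Prod.fst h
        rw [show q.1 = 0 from hq] at this
        simpa [hT, hk, hδ.ne'] using this.symm
      have := hU (φ.symm q)
      exact mem_segment_of_orient h1 h0 (by linarith) (by linarith)

namespace SimpleGraph

variable {V : Type*} {G : SimpleGraph V}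

/-- The straight-line segment representing an edge. -/
noncomputable def straightArc (P : V → ℝ × ℝ) (e : G.edgeSet) (t : ℝ) : ℝ × ℝ :=
  AffineMap.lineMap (P (Quot.out (e : Sym2 V)).1) (P (Quot.out (e : Sym2 V)).2) t

theorem straightArc_image (P : V → ℝ × ℝ) {u v : V} (h : s(u, v) ∈ G.edgeSet) :
    straightArc P ⟨s(u, v), h⟩ '' Icc 0 1 = segment ℝ (P u) (P v) := by
  change (fun t : ℝ => (AffineMap.lineMap _ _ t : ℝ × ℝ)) '' Icc 0 1 = _
  rw [← segment_eq_image_lineMap]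
  have : s((Quot.out s(u, v)).1, (Quot.out s(u, v)).2) = s(u, v) := Quot.out_eq s(u, v)
  rcases Sym2.eq_iff.1 this with ⟨h1, h2⟩ | ⟨h1, h2⟩
  · rw [h1, h2]
  · rw [h1, h2, segment_symm]

theorem eq_of_mem_straightArc {P : V → ℝ × ℝ}
    (hgp : ∀ u v w, u ≠ v → u ≠ w → v ≠ w → orient (P u) (P v) (P w) ≠ 0) (e₁ e₂ : G.edgeSet)
    (hne : e₁ ≠ e₂) (v : V) (h1 : v ∈ (e₁ : Sym2 V)) (h2 : v ∈ (e₂ : Sym2 V)) (q : ℝ × ℝ)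
    (hq : q ∈ straightArc P e₁ '' Icc 0 1 ∩ straightArc P e₂ '' Icc 0 1) : q = P v := by
  obtain ⟨e₁, he₁⟩ := e₁
  obtain ⟨e₂, he₂⟩ := e₂
  obtain ⟨a, rfl⟩ := h1
  obtain ⟨b, rfl⟩ := h2
  rw [straightArc_image, straightArc_image] at hq
  have hab : a ≠ b := fun h => hne (by subst h; rfl)
  have hself : ∀ x y : ℝ × ℝ, orient x y x = 0 := fun x y => by simp [orient]
  apply eq_of_orient_eq (a := P v) (b := P a) (c := P v) (d := P b)
  · rw [hself]
    exact (hgp v a b (G.ne_of_adj he₁) (G.ne_of_adj he₂) hab).symm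
  · rw [hself, orient_eq_zero_of_mem_segment hq.1]
  · rw [hself, orient_eq_zero_of_mem_segment hq.2]

/-- A straight-line drawing in general position, in which only one pair of edges
crosses, is IC-planar. -/
theorem icPlanar_of_straight (P : V → ℝ × ℝ) (hP : Function.Injective P)
    (hgp : ∀ u v w, u ≠ v → u ≠ w → v ≠ w → orient (P u) (P v) (P w) ≠ 0) (f₁ f₂ : Sym2 V)
    (hX : ∀ a b c d, G.Adj a b → G.Adj c d → a ≠ c → a ≠ d → b ≠ c → b ≠ d →
      0 < orient (P a) (P b) (P c) * orient (P a) (P b) (P d) ∨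
      0 < orient (P c) (P d) (P a) * orient (P c) (P d) (P b) ∨
      s(a, b) = f₁ ∧ s(c, d) = f₂ ∨ s(a, b) = f₂ ∧ s(c, d) = f₁) :
    G.ICPlanar := by
  have hpair : ∀ e₁ e₂ : G.edgeSet, e₁ ≠ e₂ → ∀ p,
      p ∈ straightArc P e₁ '' Icc 0 1 ∩ straightArc P e₂ '' Icc 0 1 → p ∉ Set.range P →
      ((e₁ : Sym2 V) = f₁ ∧ (e₂ : Sym2 V) = f₂ ∨ (e₁ : Sym2 V) = f₂ ∧ (e₂ : Sym2 V) = f₁) ∧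
      (straightArc P e₁ '' Icc 0 1 ∩ straightArc P e₂ '' Icc 0 1).Subsingleton ∧
      ProperCross (straightArc P e₁ '' Icc 0 1) (straightArc P e₂ '' Icc 0 1) p := by
    intro e₁ e₂ hne p hp hpV
    have hdis : ∀ v, v ∈ (e₁ : Sym2 V) → v ∉ (e₂ : Sym2 V) := fun v h1 h2 =>
      hpV ⟨v, (eq_of_mem_straightArc hgp e₁ e₂ hne v h1 h2 p hp).symm⟩
    obtain ⟨e₁, he₁⟩ := e₁
    obtain ⟨e₂, he₂⟩ := e₂
    induction e₁ with | _ a b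
    induction e₂ with | _ c d
    have ha := hdis a (Sym2.mem_mk_left a b)
    have hb := hdis b (Sym2.mem_mk_right a b)
    simp only [Sym2.mem_iff, not_or] at ha hb
    rw [straightArc_image, straightArc_image] at hp ⊢
    have hab := G.ne_of_adj he₁
    have hcd := G.ne_of_adj he₂
    have n1 : ¬ 0 < orient (P a) (P b) (P c) * orient (P a) (P b) (P d) := fun h =>
      Set.disjoint_left.1 (disjoint_segment_of_orient h) hp.1 hp.2
    have n2 : ¬ 0 < orient (P c) (P d) (P a) * orient (P c) (P d) (P b) := fun h =>
      Set.disjoint_left.1 (disjoint_segment_of_orient h) hp.2 hp.1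
    have l1 := (not_lt.1 n1).lt_of_ne
      (mul_ne_zero (hgp a b c hab ha.1 hb.1) (hgp a b d hab ha.2 hb.2))
    have l2 := (not_lt.1 n2).lt_of_ne
      (mul_ne_zero (hgp c d a hcd (Ne.symm ha.1) (Ne.symm ha.2)) (hgp c d b hcd (Ne.symm hb.1) (Ne.symm hb.2)))
    refine ⟨?_, ?_, properCross_segment l1 l2 hp.1 hp.2⟩
    · rcases hX a b c d he₁ he₂ ha.1 ha.2 hb.1 hb.2 with h | h | h
      · exact (n1 h).elim
      · exact (n2 h).elim
      · exact h
    · intro x hx y hy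
      apply eq_of_orient_eq (a := P a) (b := P b) (c := P c) (d := P d)
      · intro h
        rw [h] at l1
        exact (mul_self_nonneg _).not_gt l1
      · rw [orient_eq_zero_of_mem_segment hx.1, orient_eq_zero_of_mem_segment hy.1]
      · rw [orient_eq_zero_of_mem_segment hx.2, orient_eq_zero_of_mem_segment hy.2]
  have hout : ∀ e : G.edgeSet, (Quot.out (e : Sym2 V)).1 ≠ (Quot.out (e : Sym2 V)).2 := fun e => by
    apply G.ne_of_adj
    rw [← SimpleGraph.mem_edgeSet, show s((Quot.out (e : Sym2 V)).1, (Quot.out (e : Sym2 V)).2) =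
      (e : Sym2 V) from Quot.out_eq (e : Sym2 V)]
    exact e.2
  have hvert : ∀ (e : G.edgeSet) (v : V), P v ∈ straightArc P e '' Icc 0 1 → v ∈ (e : Sym2 V) := by
    rintro ⟨e, he⟩ v h
    by_contra hv
    induction e with | _ a b
    simp only [Sym2.mem_iff, not_or] at hv
    rw [straightArc_image] at h
    exact hgp a b v (G.ne_of_adj he) (Ne.symm hv.1) (Ne.symm hv.2)
      (orient_eq_zero_of_mem_segment h)
  let D : Drawing G :=
    { pos := P
      pos_inj := hP
      arc := straightArc P
      arc_cont := fun e => by unfold straightArc; fun_prop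
      arc_inj := fun e => (AffineMap.lineMap_injective ℝ (hP.ne (hout e))).injOn
      arc_ends := fun e => ⟨(Quot.out (e : Sym2 V)).1, (Quot.out (e : Sym2 V)).2,
        (Quot.out_eq (e : Sym2 V)).symm, by simp [straightArc], by simp [straightArc]⟩
      no_vertex_interior := fun e v hv h => hv (hvert e v h)
      shared_endpoint := fun e₁ e₂ hne v h1 h2 q hq =>
        eq_of_mem_straightArc hgp e₁ e₂ hne v h1 h2 q hq
      finite_meet := fun e₁ e₂ hne => by
        by_cases hs : ∃ v, v ∈ (e₁ : Sym2 V) ∧ v ∈ (e₂ : Sym2 V)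
        · obtain ⟨v, h1, h2⟩ := hs
          exact (Set.finite_singleton (P v)).subset
            fun q hq => eq_of_mem_straightArc hgp e₁ e₂ hne v h1 h2 q hq
        · refine Set.Subsingleton.finite fun x hx y hy =>
            (hpair e₁ e₂ hne x hx ?_).2.1 hx hy
          rintro ⟨v, rfl⟩
          exact hs ⟨v, hvert e₁ v hx.1, hvert e₂ v hx.2⟩
      proper := fun e₁ e₂ hne p hp hpV => (hpair e₁ e₂ hne p hp hpV).2.2
      at_most_two := fun p hpV e₁ e₂ e₃ h1 h2 h3 => by
        by_contra! h
        have a := (hpair e₁ e₂ h.1 p ⟨h1, h2⟩ hpV).1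
        have b := (hpair e₁ e₃ h.2.1 p ⟨h1, h3⟩ hpV).1
        have c := (hpair e₂ e₃ h.2.2 p ⟨h2, h3⟩ hpV).1
        have h12 := h.1
        have h13 := h.2.1
        have h23 := h.2.2
        rw [ne_eq, Subtype.ext_iff] at h12 h13 h23
        grind }
  have hsub : D.crossings.Subsingleton := by
    rintro x ⟨hxV, e₁, e₂, hne, h1, h2⟩ y ⟨hyV, e₃, e₄, hne', h3, h4⟩
    have a := hpair e₁ e₂ hne x ⟨h1, h2⟩ hxV
    have b := hpair e₃ e₄ hne' y ⟨h3, h4⟩ hyV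
    rcases a.1 with ⟨p1, p2⟩ | ⟨p1, p2⟩ <;> rcases b.1 with ⟨p3, p4⟩ | ⟨p3, p4⟩
    · obtain rfl : e₁ = e₃ := Subtype.ext (p1.trans p3.symm)
      obtain rfl : e₂ = e₄ := Subtype.ext (p2.trans p4.symm)
      exact a.2.1 ⟨h1, h2⟩ ⟨h3, h4⟩
    · obtain rfl : e₁ = e₄ := Subtype.ext (p1.trans p4.symm)
      obtain rfl : e₂ = e₃ := Subtype.ext (p2.trans p3.symm)
      exact a.2.1 ⟨h1, h2⟩ ⟨h4, h3⟩
    · obtain rfl : e₁ = e₄ := Subtype.ext (p1.trans p4.symm)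
      obtain rfl : e₂ = e₃ := Subtype.ext (p2.trans p3.symm)
      exact a.2.1 ⟨h1, h2⟩ ⟨h4, h3⟩
    · obtain rfl : e₁ = e₃ := Subtype.ext (p1.trans p3.symm)
      obtain rfl : e₂ = e₄ := Subtype.ext (p2.trans p4.symm)
      exact a.2.1 ⟨h1, h2⟩ ⟨h3, h4⟩
  exact ⟨D, fun e x hx y hy => hsub hx.1 hy.1, fun x hx y hy hne => (hne (hsub hx hy)).elim⟩

/-- IC-planarity passes to spanning subgraphs of isomorphic copies. -/
theorem ICPlanar.of_equiv {V W : Type*} {G : SimpleGraph V} {H : SimpleGraph W}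
    (hG : G.ICPlanar) (σ : W ≃ V) (hσ : ∀ u v, H.Adj u v → G.Adj (σ u) (σ v)) : H.ICPlanar := by
  obtain ⟨D, hD, hD'⟩ := hG
  let φ : H →g G := ⟨σ, fun h => hσ _ _ h⟩
  have hφ : Function.Injective φ.mapEdgeSet := SimpleGraph.Hom.mapEdgeSet.injective φ σ.injective
  have hmem : ∀ (e : H.edgeSet) (v : W), v ∈ (e : Sym2 W) ↔ σ v ∈ (φ.mapEdgeSet e : Sym2 V) :=
    fun e v => by
      change _ ↔ σ v ∈ Sym2.map σ e
      rw [Sym2.mem_map]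
      exact ⟨fun h => ⟨v, h, rfl⟩, fun ⟨w, hw, h⟩ => σ.injective h ▸ hw⟩
  have hrange : Set.range (D.pos ∘ σ) = Set.range D.pos := σ.surjective.range_comp _
  let D' : Drawing H :=
    { pos := D.pos ∘ σ
      pos_inj := D.pos_inj.comp σ.injective
      arc := fun e => D.arc (φ.mapEdgeSet e)
      arc_cont := fun e => D.arc_cont _
      arc_inj := fun e => D.arc_inj _
      arc_ends := fun e => by
        obtain ⟨u, v, h, hu, hv⟩ := D.arc_ends (φ.mapEdgeSet e)
        refine ⟨σ.symm u, σ.symm v, ?_, by simp [hu], by simp [hv]⟩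
        apply Sym2.map.injective σ.injective
        have h : Sym2.map σ (e : Sym2 W) = s(u, v) := h
        simpa using h
      no_vertex_interior := fun e v hv =>
        D.no_vertex_interior _ _ fun h => hv ((hmem e v).2 h)
      shared_endpoint := fun e₁ e₂ hne v h1 h2 =>
        D.shared_endpoint _ _ (hφ.ne hne) _ ((hmem _ _).1 h1) ((hmem _ _).1 h2)
      finite_meet := fun e₁ e₂ hne => D.finite_meet _ _ (hφ.ne hne)
      proper := fun e₁ e₂ hne p hp hpV => D.proper _ _ (hφ.ne hne) p hp (hrange ▸ hpV)
      at_most_two := fun p hpV e₁ e₂ e₃ h1 h2 h3 => by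
        simpa only [hφ.eq_iff] using D.at_most_two p (hrange ▸ hpV) _ _ _ h1 h2 h3 }
  have hcr : ∀ p ∈ D'.crossings, p ∈ D.crossings := fun p ⟨hpV, e₁, e₂, hne, h1, h2⟩ =>
    ⟨hrange ▸ hpV, _, _, hφ.ne hne, h1, h2⟩
  refine ⟨D', fun e x hx y hy => hD (φ.mapEdgeSet e) ⟨hcr x hx.1, hx.2⟩ ⟨hcr y hy.1, hy.2⟩,
    fun x hx y hy hne => ?_⟩
  have := hD' x (hcr x hx) y (hcr y hy) hne
  rw [Set.eq_empty_iff_forall_notMem] at this ⊢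
  rintro v ⟨⟨e, he, hve⟩, e', he', hve'⟩
  exact this (σ v) ⟨⟨_, he, (hmem _ _).1 hve⟩, _, he', (hmem _ _).1 hve'⟩

theorem ICPlanar.nicPlanar (h : G.ICPlanar) : G.NICPlanar := by
  obtain ⟨D, h1, h2⟩ := h
  exact ⟨D, h1, fun x hx y hy hne => by simp [h2 x hx y hy hne]⟩

/-- A straight-line drawing with integer coordinates. -/
theorem icPlanar_of_int (P : V → ℤ × ℤ) (hP : Function.Injective P)
    (hgp : ∀ u v w, u ≠ v → u ≠ w → v ≠ w → orient (P u) (P v) (P w) ≠ 0) (f₁ f₂ : Sym2 V)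
    (hX : ∀ a b c d, G.Adj a b → G.Adj c d → a ≠ c → a ≠ d → b ≠ c → b ≠ d →
      0 < orient (P a) (P b) (P c) * orient (P a) (P b) (P d) ∨
      0 < orient (P c) (P d) (P a) * orient (P c) (P d) (P b) ∨
      s(a, b) = f₁ ∧ s(c, d) = f₂ ∨ s(a, b) = f₂ ∧ s(c, d) = f₁) :
    G.ICPlanar := by
  refine icPlanar_of_straight (fun v => (P v).map Int.cast Int.cast) (fun u v h => hP ?_)
    (fun u v w h1 h2 h3 => ?_) f₁ f₂ fun a b c d h1 h2 h3 h4 h5 h6 => ?_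
  · simpa [Prod.ext_iff] using h
  · rw [orient_map_intCast]
    exact_mod_cast hgp u v w h1 h2 h3
  · simp only [orient_map_intCast]
    exact_mod_cast hX a b c d h1 h2 h3 h4 h5 h6

/-- Coordinates: `a b c d e f` with the edges `ab` and `ac` missing. -/
theorem icPlanar_top_deleteEdges_adjacent :
    ((⊤ : SimpleGraph (Fin 6)).deleteEdges {s(0, 1), s(0, 2)}).ICPlanar := by
  refine icPlanar_of_int ![(0, 1), (-9, -10), (9, -10), (0, 10), (-1, 0), (1, 0)]
    (by decide) (by decide) s(4, 2) s(5, 1) ?_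
  simp only [SimpleGraph.deleteEdges_adj, SimpleGraph.top_adj, Set.mem_insert_iff,
    Set.mem_singleton_iff]
  decide

/-- Coordinates: `a b c d e f` with the edges `ab` and `cd` missing. -/
theorem icPlanar_top_deleteEdges_disjoint :
    ((⊤ : SimpleGraph (Fin 6)).deleteEdges {s(0, 1), s(2, 3)}).ICPlanar := by
  refine icPlanar_of_int ![(2, 0), (-10, -11), (-2, 0), (10, -10), (0, 10), (0, -5)]
    (by decide) (by decide) s(0, 2) s(4, 5) ?_
  simp only [SimpleGraph.deleteEdges_adj, SimpleGraph.top_adj, Set.mem_insert_iff,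
    Set.mem_singleton_iff]
  decide

theorem icPlanar_top_deleteEdges_pair {e₁ e₂ : Sym2 (Fin 6)} (h₁ : ¬ e₁.IsDiag)
    (h₂ : ¬ e₂.IsDiag) (hne : e₁ ≠ e₂) :
    ((⊤ : SimpleGraph (Fin 6)).deleteEdges {e₁, e₂}).ICPlanar := by
  have transport : ∀ {f₁ f₂ : Sym2 (Fin 6)} (σ : Equiv.Perm (Fin 6)),
      ((⊤ : SimpleGraph (Fin 6)).deleteEdges {f₁, f₂}).ICPlanar → f₁.map σ = e₁ →
      f₂.map σ = e₂ → ((⊤ : SimpleGraph (Fin 6)).deleteEdges {e₁, e₂}).ICPlanar := by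
    rintro f₁ f₂ σ h rfl rfl
    refine h.of_equiv σ.symm fun u v huv => ?_
    obtain ⟨u, rfl⟩ := σ.surjective u
    obtain ⟨v, rfl⟩ := σ.surjective v
    simp only [SimpleGraph.deleteEdges_adj, SimpleGraph.top_adj, Set.mem_insert_iff,
      Set.mem_singleton_iff, σ.symm_apply_apply] at huv ⊢
    refine ⟨fun h => huv.1 (by rw [h]), fun h => huv.2 ?_⟩
    rcases h with rfl | rfl
    · exact Or.inl rfl
    · exact Or.inr rfl
  by_cases hs : ∃ v, v ∈ e₁ ∧ v ∈ e₂
  · obtain ⟨v, ⟨a, rfl⟩, ⟨b, rfl⟩⟩ := hs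
    have hab : a ≠ b := fun h => hne (by rw [h])
    rw [Sym2.mk_isDiag_iff] at h₁ h₂
    have hinj : Function.Injective ![v, a, b] := by
      intro i j; fin_cases i <;> fin_cases j <;> simp_all [eq_comm]
    obtain ⟨σ, hσ⟩ := MulAction.isMultiplyPretransitive_iff.1
      (Equiv.Perm.isMultiplyPretransitive (Fin 6) 3) ⟨![0, 1, 2], by decide⟩ ⟨_, hinj⟩
    have h0 : σ 0 = v := DFunLike.congr_fun hσ 0
    have h1 : σ 1 = a := DFunLike.congr_fun hσ 1
    have h2 : σ 2 = b := DFunLike.congr_fun hσ 2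
    exact transport σ icPlanar_top_deleteEdges_adjacent (by simp [h0, h1]) (by simp [h0, h2])
  · induction e₁ with | _ a b
    induction e₂ with | _ c d
    rw [Sym2.mk_isDiag_iff] at h₁ h₂
    have ha : a ∉ s(c, d) := fun h => hs ⟨a, Sym2.mem_mk_left _ _, h⟩
    have hb : b ∉ s(c, d) := fun h => hs ⟨b, Sym2.mem_mk_right _ _, h⟩
    simp only [Sym2.mem_iff, not_or] at ha hb
    have hinj : Function.Injective ![a, b, c, d] := by
      intro i j; fin_cases i <;> fin_cases j <;> simp_all [eq_comm]
    obtain ⟨σ, hσ⟩ := MulAction.isMultiplyPretransitive_iff.1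
      (Equiv.Perm.isMultiplyPretransitive (Fin 6) 4) ⟨![0, 1, 2, 3], by decide⟩ ⟨_, hinj⟩
    have h0 : σ 0 = a := DFunLike.congr_fun hσ 0
    have h1 : σ 1 = b := DFunLike.congr_fun hσ 1
    have h2 : σ 2 = c := DFunLike.congr_fun hσ 2
    have h3 : σ 3 = d := DFunLike.congr_fun hσ 3
    exact transport σ icPlanar_top_deleteEdges_disjoint (by simp [h0, h1]) (by simp [h2, h3])

end SimpleGraph

/-- `K₆` minus one edge is not NIC-planar, while `K₆` minus any
two distinct edges is IC-planar (and hence NIC-planar). -/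
theorem stmt16 :
    (∀ e ∈ (⊤ : SimpleGraph (Fin 6)).edgeSet,
        ¬ ((⊤ : SimpleGraph (Fin 6)).deleteEdges {e}).NICPlanar) ∧
    (∀ e₁ ∈ (⊤ : SimpleGraph (Fin 6)).edgeSet,
      ∀ e₂ ∈ (⊤ : SimpleGraph (Fin 6)).edgeSet, e₁ ≠ e₂ →
        ((⊤ : SimpleGraph (Fin 6)).deleteEdges {e₁, e₂}).ICPlanar ∧
        ((⊤ : SimpleGraph (Fin 6)).deleteEdges {e₁, e₂}).NICPlanar) := by
  refine ⟨fun e _ => not_nicPlanar_top_deleteEdges_singleton e, fun e₁ h₁ e₂ h₂ hne => ?_⟩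
  have h := SimpleGraph.icPlanar_top_deleteEdges_pair (SimpleGraph.not_isDiag_of_mem_edgeSet _ h₁)
    (SimpleGraph.not_isDiag_of_mem_edgeSet _ h₂) hne
  exact ⟨h, h.nicPlanar⟩
end

section
/- The complete bipartite graph K_{3,5} and the complete tripartite graph K_{2,2,3} are both minimum non-NIC-planar graphs: neither is NIC-planar, but deleting any single edge from either of them yields an NIC-planar graph. -/
open Set

/-- A continuous nonvanishing function on a simply connected space has a continuous logarithm. -/
theorem exists_continuous_log_s18 {A : Type*} [TopologicalSpace A] [SimplyConnectedSpace A]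
    [LocallyPathConnectedSpace A] {f : A → ℂ} (hf : Continuous f) (h0 : ∀ a, f a ≠ 0) :
    ∃ g : A → ℂ, Continuous g ∧ ∀ a, Complex.exp (g a) = f a := by
  obtain ⟨a₀⟩ : Nonempty A := inferInstance
  obtain ⟨F, ⟨-, hF⟩, -⟩ := Complex.isCoveringMapOn_exp.existsUnique_continuousMap_lifts
    (A := A) ⟨f, hf⟩ (a₀ := a₀) (e₀ := Complex.log (f a₀)) (Complex.exp_log (h0 a₀))
    (fun a => h0 a)
  exact ⟨F, F.continuous, fun a => congrFun hF a⟩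

/-- The increment over `[0, 1]` of a continuous logarithm of `f`. -/
def IsLogIncrement (f : ℝ → ℂ) (d : ℂ) : Prop :=
  ∀ g : ℝ → ℂ, Continuous g → (∀ s, Complex.exp (g s) = f s) → g 1 - g 0 = d

theorem exists_isLogIncrement {f : ℝ → ℂ} (hf : Continuous f) (h0 : ∀ s, f s ≠ 0) :
    ∃ d, IsLogIncrement f d := by
  obtain ⟨g, hg, hgf⟩ := exists_continuous_log_s18 hf h0
  refine ⟨g 1 - g 0, fun g' hg' hgf' => ?_⟩
  have hexists : ∀ s, ∃ n : ℤ, (g' s - g s) / (2 * Real.pi * Complex.I) = n := fun s => by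
    obtain ⟨n, hn⟩ := Complex.exp_eq_exp_iff_exists_int.1 ((hgf' s).trans (hgf s).symm)
    refine ⟨n, ?_⟩
    rw [hn, add_sub_cancel_left, mul_div_cancel_right₀ _ Complex.two_pi_I_ne_zero]
  choose n hn using hexists
  have hncont : Continuous n := by
    have : Continuous fun s => ((n s : ℤ) : ℂ) := by
      simp_rw [← hn]; fun_prop
    exact Complex.isClosedEmbedding_intCast.isInducing.continuous_iff.2 this
  have hconst : n 1 = n 0 := PreconnectedSpace.constant inferInstance hncont
  have h1 := hn 1
  have h2 := hn 0
  rw [hconst, ← h2, div_left_inj' Complex.two_pi_I_ne_zero] at h1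
  linear_combination h1

theorem IsLogIncrement.exists_int {f : ℝ → ℂ} {d : ℂ} (hd : IsLogIncrement f d)
    (hf : Continuous f) (h0 : ∀ s, f s ≠ 0) :
    ∃ n : ℤ, d = Complex.log (f 1) - Complex.log (f 0) + n * (2 * Real.pi * Complex.I) := by
  obtain ⟨g, hg, hgf⟩ := exists_continuous_log_s18 hf h0
  obtain ⟨m, hm⟩ := Complex.exp_eq_exp_iff_exists_int.1
    ((hgf 1).trans (Complex.exp_log (h0 1)).symm)
  obtain ⟨k, hk⟩ := Complex.exp_eq_exp_iff_exists_int.1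
    ((hgf 0).trans (Complex.exp_log (h0 0)).symm)
  refine ⟨m - k, ?_⟩
  rw [← hd g hg hgf, hm, hk]
  push_cast
  ring

theorem IsLogIncrement.of_neg {f : ℝ → ℂ} {d : ℂ} (hd : IsLogIncrement f d) {g : ℝ → ℂ}
    (hg : Continuous g) (hgf : ∀ s, Complex.exp (g s) = -f s) : g 1 - g 0 = d := by
  have := hd (fun s => g s + Real.pi * Complex.I) (by fun_prop)
    (fun s => by rw [Complex.exp_add, hgf, Complex.exp_pi_mul_I]; ring)
  rw [← this]
  ring

theorem log_neg_eq {z : ℂ} (hz : z ≠ 0) :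
    ∃ n : ℤ, Complex.log (-z) = Complex.log z + (2 * n + 1) * (Real.pi * Complex.I) := by
  have h : Complex.exp (Complex.log (-z)) = Complex.exp (Complex.log z + Real.pi * Complex.I) := by
    rw [Complex.exp_log (neg_ne_zero.2 hz), Complex.exp_add, Complex.exp_log hz,
      Complex.exp_pi_mul_I]
    ring
  obtain ⟨n, hn⟩ := Complex.exp_eq_exp_iff_exists_int.1 h
  exact ⟨n, by rw [hn]; ring⟩

/-- For disjoint paths `P` and `Q`, the change of the logarithm of `P s - Q t` around the boundary
of the parameter square vanishes. -/
theorem logIncrement_square {P Q : ℝ → ℂ} (hP : Continuous P) (hQ : Continuous Q)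
    (hPQ : ∀ s t, P s ≠ Q t) {d₁ d₂ d₃ d₄ : ℂ}
    (h₁ : IsLogIncrement (fun s => P s - Q 0) d₁) (h₂ : IsLogIncrement (fun t => Q t - P 1) d₂)
    (h₃ : IsLogIncrement (fun t => Q t - P 0) d₃) (h₄ : IsLogIncrement (fun s => P s - Q 1) d₄) :
    d₁ + d₂ = d₃ + d₄ := by
  obtain ⟨g, hg, hgf⟩ := exists_continuous_log_s18 (A := ℝ × ℝ) (f := fun x => P x.1 - Q x.2)
    (by fun_prop) (fun x => sub_ne_zero.2 (hPQ _ _))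
  rw [← h₁ (fun s => g (s, 0)) (by fun_prop) (fun s => hgf _),
    ← h₄ (fun s => g (s, 1)) (by fun_prop) (fun s => hgf _),
    ← h₂.of_neg (g := fun t => g (1, t)) (by fun_prop) (fun s => by rw [hgf]; ring),
    ← h₃.of_neg (g := fun t => g (0, t)) (by fun_prop) (fun s => by rw [hgf]; ring)]
  ring

/-- There is no map of `K_{3,3}` to the plane in which vertex-disjoint edges have disjoint
images. -/
theorem not_disjoint_K33 {a b : Fin 3 → ℂ} {P : Fin 3 → Fin 3 → ℝ → ℂ}
    (hP : ∀ i j, Continuous (P i j)) (hP0 : ∀ i j, P i j 0 = a i) (hP1 : ∀ i j, P i j 1 = b j)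
    (hdisj : ∀ i j k l, i ≠ k → j ≠ l → ∀ s t, P i j s ≠ P k l t) : False := by
  have other : ∀ j : Fin 3, ∃ l, j ≠ l := by decide
  have haP : ∀ k i j, k ≠ i → ∀ s, P i j s ≠ a k := fun k i j hk s => by
    obtain ⟨l, hl⟩ := other j
    rw [← hP0 k l]
    exact hdisj i j k l hk.symm hl s 0
  have hbP : ∀ l i j, l ≠ j → ∀ s, P i j s ≠ b l := fun l i j hl s => by
    obtain ⟨k, hk⟩ := other i
    rw [← hP1 k l]
    exact hdisj i j k l hk hl.symm s 1
  have haa : ∀ i k, i ≠ k → a i - a k ≠ 0 := fun i k h =>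
    sub_ne_zero.2 (hP0 i 0 ▸ haP k i 0 h.symm 0)
  have hbb : ∀ j l, j ≠ l → b j - b l ≠ 0 := fun j l h =>
    sub_ne_zero.2 (hP1 0 j ▸ hbP l 0 j h.symm 1)
  have hba : ∀ k j, b j - a k ≠ 0 := fun k j => by
    obtain ⟨i, hi⟩ := other k
    exact sub_ne_zero.2 (hP1 i j ▸ haP k i j hi 1)
  have hn : ∀ k i j, ∃ d, ∃ n : ℤ, k ≠ i → IsLogIncrement (fun s => P i j s - a k) d ∧
      d = Complex.log (b j - a k) - Complex.log (a i - a k) + n * (2 * Real.pi * Complex.I) := by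
    intro k i j
    by_cases hk : k = i
    · exact ⟨0, 0, fun h => absurd hk h⟩
    have hc : Continuous fun s => P i j s - a k := (hP i j).sub continuous_const
    have h0 : ∀ s, P i j s - a k ≠ 0 := fun s => sub_ne_zero.2 (haP k i j hk s)
    obtain ⟨d, hd⟩ := exists_isLogIncrement hc h0
    obtain ⟨n, hn⟩ := hd.exists_int hc h0
    exact ⟨d, n, fun _ => ⟨hd, by simpa [hP0, hP1] using hn⟩⟩
  have hm : ∀ l i j, ∃ d, ∃ n : ℤ, l ≠ j → IsLogIncrement (fun s => P i j s - b l) d ∧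
      d = Complex.log (b j - b l) - Complex.log (a i - b l) + n * (2 * Real.pi * Complex.I) := by
    intro l i j
    by_cases hl : l = j
    · exact ⟨0, 0, fun h => absurd hl h⟩
    have hc : Continuous fun s => P i j s - b l := (hP i j).sub continuous_const
    have h0 : ∀ s, P i j s - b l ≠ 0 := fun s => sub_ne_zero.2 (hbP l i j hl s)
    obtain ⟨d, hd⟩ := exists_isLogIncrement hc h0
    obtain ⟨n, hn⟩ := hd.exists_int hc h0
    exact ⟨d, n, fun _ => ⟨hd, by simpa [hP0, hP1] using hn⟩⟩
  choose d n hdn using hn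
  choose d' m hdm using hm
  have hε : ∀ i k, ∃ e : ℤ, i ≠ k → Complex.log (a k - a i) =
      Complex.log (a i - a k) + (2 * e + 1) * (Real.pi * Complex.I) := fun i k => by
    by_cases h : i = k
    · exact ⟨0, fun h' => absurd h h'⟩
    obtain ⟨e, he⟩ := log_neg_eq (haa i k h)
    exact ⟨e, fun _ => by rw [← he, neg_sub]⟩
  have hη : ∀ j l, ∃ e : ℤ, j ≠ l → Complex.log (b l - b j) =
      Complex.log (b j - b l) + (2 * e + 1) * (Real.pi * Complex.I) := fun j l => by
    by_cases h : j = l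
    · exact ⟨0, fun h' => absurd h h'⟩
    obtain ⟨e, he⟩ := log_neg_eq (hbb j l h)
    exact ⟨e, fun _ => by rw [← he, neg_sub]⟩
  have hδ : ∀ k j, ∃ e : ℤ, Complex.log (a k - b j) =
      Complex.log (b j - a k) + (2 * e + 1) * (Real.pi * Complex.I) := fun k j => by
    obtain ⟨e, he⟩ := log_neg_eq (hba k j)
    exact ⟨e, by rw [← he, neg_sub]⟩
  choose ε hε using hε
  choose η hη using hη
  choose δ hδ using hδ
  have key : ∀ i j k l, i ≠ k → j ≠ l →
      (2 * ε i k + 1) - (2 * η l j + 1) - (2 * δ k j + 1) + (2 * δ i l + 1)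
        + 2 * (n k i j + m j k l - n i k l - m l i j) = 0 := by
    intro i j k l hik hjl
    have h := logIncrement_square (hP i j) (hP k l) (hdisj i j k l hik hjl)
      (by simpa [hP0] using (hdn k i j hik.symm).1) (by simpa [hP1] using (hdm j k l hjl).1)
      (by simpa [hP0] using (hdn i k l hik).1) (by simpa [hP1] using (hdm l i j hjl.symm).1)
    rw [(hdn k i j hik.symm).2, (hdm j k l hjl).2, (hdn i k l hik).2, (hdm l i j hjl.symm).2,
      hε i k hik, hη l j hjl.symm, hδ, hδ] at h
    have hpi : (Real.pi * Complex.I : ℂ) ≠ 0 := by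
      simp [Real.pi_ne_zero]
    have h' : (((2 * ε i k + 1) - (2 * η l j + 1) - (2 * δ k j + 1) + (2 * δ i l + 1)
        + 2 * (n k i j + m j k l - n i k l - m l i j) : ℤ) : ℂ) * (Real.pi * Complex.I) = 0 := by
      push_cast
      linear_combination h
    exact_mod_cast (mul_eq_zero.1 h').resolve_right hpi
  have hanti : ∀ j l, j ≠ l → η j l + η l j + 1 = 0 := fun j l hjl => by
    have h₁ := hη j l hjl
    rw [hη l j hjl.symm] at h₁
    have hpi : (Real.pi * Complex.I : ℂ) ≠ 0 := by simp [Real.pi_ne_zero]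
    have h' : ((η j l + η l j + 1 : ℤ) : ℂ) * (Real.pi * Complex.I) = 0 := by
      push_cast
      linear_combination -h₁ / 2
    exact_mod_cast (mul_eq_zero.1 h').resolve_right hpi
  have sum : ∀ i k, i ≠ k → ∃ N : ℤ, 6 * (2 * ε i k + 1) + 4 * N +
      2 * ((m 0 k 1 + m 0 k 2 + m 1 k 0 + m 1 k 2 + m 2 k 0 + m 2 k 1) -
        (m 0 i 1 + m 0 i 2 + m 1 i 0 + m 1 i 2 + m 2 i 0 + m 2 i 1)) = 0 := fun i k hik => by
    refine ⟨n k i 0 + n k i 1 + n k i 2 - n i k 0 - n i k 1 - n i k 2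
      - (δ k 0 + δ k 1 + δ k 2) + (δ i 0 + δ i 1 + δ i 2), ?_⟩
    linear_combination key i 0 k 1 hik (by decide) + key i 0 k 2 hik (by decide) +
      key i 1 k 0 hik (by decide) + key i 1 k 2 hik (by decide) +
      key i 2 k 0 hik (by decide) + key i 2 k 1 hik (by decide) +
      2 * hanti 0 1 (by decide) + 2 * hanti 0 2 (by decide) + 2 * hanti 1 2 (by decide)
  obtain ⟨N₁, h₁⟩ := sum 0 1 (by decide)
  obtain ⟨N₂, h₂⟩ := sum 0 2 (by decide)
  obtain ⟨N₃, h₃⟩ := sum 1 2 (by decide)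
  omega

/-- There are no three points and three further points of the plane joined pairwise inside sets
that are disjoint for vertex-disjoint pairs. -/
theorem not_joinedIn_K33 {a b : Fin 3 → ℝ × ℝ} {S : Fin 3 → Fin 3 → Set (ℝ × ℝ)}
    (hS : ∀ i j, JoinedIn (S i j) (a i) (b j))
    (hdisj : ∀ i j k l, i ≠ k → j ≠ l → Disjoint (S i j) (S k l)) : False := by
  let ψ := Complex.equivRealProdCLM.symm
  refine not_disjoint_K33 (a := fun i => ψ (a i)) (b := fun j => ψ (b j))
    (P := fun i j s => ψ ((hS i j).somePath.extend s)) (fun i j => ?_) (fun i j => ?_)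
    (fun i j => ?_) (fun i j k l hik hjl s t h => ?_)
  · exact ψ.continuous.comp (hS i j).somePath.continuous_extend
  · simp
  · simp
  · have hs : (hS i j).somePath.extend s ∈ S i j := (hS i j).somePath_mem _
    have ht : (hS k l).somePath.extend t ∈ S k l := (hS k l).somePath_mem _
    rw [ψ.injective h] at hs
    exact Set.disjoint_left.1 (hdisj i j k l hik hjl) hs ht

namespace Drawing

variable {V : Type*} {G : SimpleGraph V}

/-- Two distinct edges have arcs meeting in a crossing. -/
def Crosses (D : Drawing G) (e f : Sym2 V) : Prop :=
  e ≠ f ∧ ∃ (he : e ∈ G.edgeSet) (hf : f ∈ G.edgeSet),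
    ∃ c ∉ Set.range D.pos, c ∈ D.arcIm ⟨e, he⟩ ∧ c ∈ D.arcIm ⟨f, hf⟩

theorem joinedIn_arcIm (D : Drawing G) {u v : V} (h : G.Adj u v) :
    JoinedIn (D.arcIm ⟨s(u, v), h⟩) (D.pos u) (D.pos v) := by
  set e : G.edgeSet := ⟨s(u, v), h⟩
  have hpath : IsPathConnected (D.arcIm e) :=
    ((convex_Icc (0 : ℝ) 1).isPathConnected ⟨0, by simp⟩).image' (D.arc_cont e)
  have h0 : D.arc e 0 ∈ D.arcIm e := mem_image_of_mem _ (by simp)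
  have h1 : D.arc e 1 ∈ D.arcIm e := mem_image_of_mem _ (by simp)
  obtain ⟨x, y, hxy, hx, hy⟩ := D.arc_ends e
  rw [hx] at h0
  rw [hy] at h1
  obtain ⟨rfl, rfl⟩ | ⟨rfl, rfl⟩ := Sym2.eq_iff.1 hxy
  · exact hpath.joinedIn _ h0 _ h1
  · exact hpath.joinedIn _ h1 _ h0

theorem Crosses.of_mem {D : Drawing G} {e f : Sym2 V} (he : e ∈ G.edgeSet) (hf : f ∈ G.edgeSet)
    (hef : ∀ v ∈ e, v ∉ f) {c : ℝ × ℝ} (hce : c ∈ D.arcIm ⟨e, he⟩) (hcf : c ∈ D.arcIm ⟨f, hf⟩) :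
    D.Crosses e f := by
  refine ⟨?_, he, hf, c, ?_, hce, hcf⟩
  · rintro rfl
    induction e with
    | _ x y => exact hef x (by simp) (by simp)
  · rintro ⟨v, rfl⟩
    refine hef v ?_ ?_
    · by_contra h
      exact D.no_vertex_interior ⟨e, he⟩ v h hce
    · by_contra h
      exact D.no_vertex_interior ⟨f, hf⟩ v h hcf

/-- In an NIC-planar drawing, two crossing pairs of edges coincide or have at most one common
end-vertex. -/
theorem IsNICPlanar.eq_or_eq_of_crosses [Finite V] {D : Drawing G} (hD : D.IsNICPlanar)
    {e f e' f' : Sym2 V} (h : D.Crosses e f) (h' : D.Crosses e' f') :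
    (e' = e ∧ f' = f) ∨ (e' = f ∧ f' = e) ∨
      ∀ x y, (x ∈ e ∨ x ∈ f) → (x ∈ e' ∨ x ∈ f') → (y ∈ e ∨ y ∈ f) → (y ∈ e' ∨ y ∈ f') →
        x = y := by
  obtain ⟨hne, he, hf, c, hc, hce, hcf⟩ := h
  obtain ⟨hne', he', hf', c', hc', hce', hcf'⟩ := h'
  by_cases hcc : c = c'
  · subst hcc
    have h₁ := D.at_most_two c hc ⟨e, he⟩ ⟨f, hf⟩ ⟨e', he'⟩ hce hcf hce'
    have h₂ := D.at_most_two c hc ⟨e, he⟩ ⟨f, hf⟩ ⟨f', hf'⟩ hce hcf hcf'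
    simp only [Subtype.mk.injEq] at h₁ h₂
    grind
  · refine Or.inr (Or.inr fun x y hx hx' hy hy' => ?_)
    have hcr : c ∈ D.crossings :=
      ⟨hc, ⟨e, he⟩, ⟨f, hf⟩, by simpa using hne, hce, hcf⟩
    have hcr' : c' ∈ D.crossings :=
      ⟨hc', ⟨e', he'⟩, ⟨f', hf'⟩, by simpa using hne', hce', hcf'⟩
    have hle := (Set.ncard_le_one (Set.toFinite _)).1 (hD.2 c hcr c' hcr' hcc)
    have mem : ∀ z, (z ∈ e ∨ z ∈ f) → z ∈ D.cluster c := fun z hz => by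
      rcases hz with hz | hz
      exacts [⟨⟨e, he⟩, hce, hz⟩, ⟨⟨f, hf⟩, hcf, hz⟩]
    have mem' : ∀ z, (z ∈ e' ∨ z ∈ f') → z ∈ D.cluster c' := fun z hz => by
      rcases hz with hz | hz
      exacts [⟨⟨e', he'⟩, hce', hz⟩, ⟨⟨f', hf'⟩, hcf', hz⟩]
    exact hle x ⟨mem x hx, mem' x hx'⟩ y ⟨mem y hy, mem' y hy'⟩

/-- In a subdivision of `K_{3,3}` with branch vertices `p i` and `q j`, where each edge is
subdivided at most once (at `r i j`), some two vertex-disjoint paths contain crossing edges. -/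
theorem exists_crosses_of_K33 (D : Drawing G) {p q : Fin 3 → V} {r : Fin 3 → Fin 3 → V}
    (hpr : ∀ i j, r i j = p i ∨ G.Adj (p i) (r i j)) (hrq : ∀ i j, G.Adj (r i j) (q j))
    (hdisj : ∀ i j k l, i ≠ k → j ≠ l → ∀ x, (x = p i ∨ x = r i j ∨ x = q j) →
      ¬ (x = p k ∨ x = r k l ∨ x = q l)) :
    ∃ i j k l, i ≠ k ∧ j ≠ l ∧ ∃ e f, (e = s(p i, r i j) ∨ e = s(r i j, q j)) ∧
      (f = s(p k, r k l) ∨ f = s(r k l, q l)) ∧ D.Crosses e f := by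
  by_contra hno
  push Not at hno
  refine not_joinedIn_K33 (a := D.pos ∘ p) (b := D.pos ∘ q)
    (S := fun i j => {c | ∃ e : G.edgeSet,
      ((e : Sym2 V) = s(p i, r i j) ∨ (e : Sym2 V) = s(r i j, q j)) ∧ c ∈ D.arcIm e})
    (fun i j => ?_) (fun i j k l hik hjl => ?_)
  · have h₂ : JoinedIn {c | ∃ e : G.edgeSet,
        ((e : Sym2 V) = s(p i, r i j) ∨ (e : Sym2 V) = s(r i j, q j)) ∧ c ∈ D.arcIm e}
        (D.pos (r i j)) (D.pos (q j)) :=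
      JoinedIn.mono (D.joinedIn_arcIm (hrq i j)) fun c hc =>
        ⟨⟨s(r i j, q j), hrq i j⟩, Or.inr rfl, hc⟩
    rcases hpr i j with h | h
    · rw [h] at h₂ ⊢
      exact h₂
    · refine JoinedIn.trans (JoinedIn.mono (D.joinedIn_arcIm h) fun c hc => ?_) h₂
      exact ⟨⟨s(p i, r i j), h⟩, Or.inl rfl, hc⟩
  · refine Set.disjoint_left.2 ?_
    rintro c ⟨⟨e, he⟩, hep, hce⟩ ⟨⟨f, hf⟩, hfp, hcf⟩
    refine hno i j k l hik hjl e f hep hfp (Crosses.of_mem he hf (fun v hv hv' => ?_) hce hcf)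
    refine hdisj i j k l hik hjl v ?_ ?_
    · rcases hep with rfl | rfl <;> simp at hv <;> tauto
    · rcases hfp with rfl | rfl <;> simp at hv' <;> tauto

/-- Every drawing of `K_{3,3}` has two vertex-disjoint edges that cross. -/
theorem exists_crosses_of_complete (D : Drawing G) {p q : Fin 3 → V} (hp : Function.Injective p)
    (hq : Function.Injective q) (hpq : ∀ i j, G.Adj (p i) (q j)) :
    ∃ i j k l, i ≠ k ∧ j ≠ l ∧ D.Crosses s(p i, q j) s(p k, q l) := by
  obtain ⟨i, j, k, l, hik, hjl, e, f, he, hf, hc⟩ := D.exists_crosses_of_K33 (p := p) (q := q)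
    (r := fun i _ => p i) (fun _ _ => Or.inl rfl) hpq (fun i j k l hik hjl x hx hx' => by
      have h₁ := hp.ne hik
      have h₂ := hq.ne hjl
      have h₃ := (hpq i l).ne
      have h₄ := (hpq k j).ne
      grind)
  refine ⟨i, j, k, l, hik, hjl, ?_⟩
  obtain ⟨-, he', hf', -⟩ := id hc
  rcases he with rfl | rfl
  · simp at he'
  rcases hf with rfl | rfl
  · simp at hf'
  exact hc

theorem Crosses.disjoint {D : Drawing G} {e f : Sym2 V} (h : D.Crosses e f) {v : V}
    (he : v ∈ e) : v ∉ f := fun hf => by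
  obtain ⟨hne, he', hf', c, hc, hce, hcf⟩ := h
  refine hc ⟨v, ?_⟩
  exact (D.shared_endpoint ⟨e, he'⟩ ⟨f, hf'⟩ (by simpa using hne) v he hf ⟨hce, hcf⟩).symm

/-- Two crossing pairs of edges between a set of three vertices and its complement, in an
NIC-planar drawing, either coincide or involve disjoint pairs in the complement and distinct pairs
in the set of three vertices. -/
theorem IsNICPlanar.ne_of_crosses [Finite V] {D : Drawing G} (hD : D.IsNICPlanar) {ι : Type*}
    {a : Fin 3 → V} {b : ι → V} (ha : Function.Injective a) (hb : Function.Injective b)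
    (hab : ∀ i j, a i ≠ b j) {i k i' k' : Fin 3} {y z y' z' : ι} (hik : i ≠ k) (hik' : i' ≠ k')
    (hy : y' ≠ y) (hz : z' ≠ y) (h : D.Crosses s(a i, b y) s(a k, b z))
    (h' : D.Crosses s(a i', b y') s(a k', b z')) :
    (y' ≠ z ∧ z' ≠ z) ∧ ¬ ((i = i' ∨ i = k') ∧ (k = i' ∨ k = k')) := by
  have common : ∀ i k i' k' : Fin 3, i ≠ k → i' ≠ k' →
      ∃ m, (m = i ∨ m = k) ∧ (m = i' ∨ m = k') := by decide
  obtain ⟨m, hm, hm'⟩ := common i k i' k' hik hik'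
  rcases hD.eq_or_eq_of_crosses h h' with ⟨h, -⟩ | ⟨-, h⟩ | h
  · simp [hab, (hab _ _).symm, hb.eq_iff, hy] at h
  · simp [hab, (hab _ _).symm, hb.eq_iff, hz] at h
  · have hbz := fun hh hh' => hab _ _ (h (a m) (b z) (by rcases hm with rfl | rfl <;> simp)
      (by rcases hm' with rfl | rfl <;> simp) hh hh')
    refine ⟨⟨?_, ?_⟩, fun hh => hik (ha (h (a i) (a k) (by simp) ?_ (by simp) ?_))⟩
    · rintro rfl
      simp at hbz
    · rintro rfl
      simp at hbz
    · rcases hh.1 with rfl | rfl <;> simp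
    · rcases hh.2 with rfl | rfl <;> simp

/-- In an NIC-planar drawing of a graph with three vertices joined to five others, any two
distinct crossings would use disjoint pairs among the five vertices. Deleting suitable vertices
would leave a planar drawing of `K_{3,3}`. -/
theorem not_isNICPlanar_of_K35 [Finite V] (D : Drawing G) {a : Fin 3 → V} {b : Fin 5 → V}
    (ha : Function.Injective a) (hb : Function.Injective b) (hab : ∀ i j, G.Adj (a i) (b j)) :
    ¬ D.IsNICPlanar := by
  intro hD
  have hne : ∀ i j, a i ≠ b j := fun i j => (hab i j).ne
  have avoid : ∀ u v : Fin 5, ∃ t : Fin 3 → Fin 5, Function.Injective t ∧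
      ∀ i, t i ≠ u ∧ t i ≠ v := fun u v => by
    obtain ⟨x, y, z, hxy, hyz, hxz, h⟩ : ∃ x y z : Fin 5, x ≠ y ∧ y ≠ z ∧ x ≠ z ∧
        (x ≠ u ∧ x ≠ v) ∧ (y ≠ u ∧ y ≠ v) ∧ z ≠ u ∧ z ≠ v := by decide +revert
    refine ⟨![x, y, z], fun i j hij => ?_, ?_⟩
    · fin_cases i <;> fin_cases j <;> simp_all
    · simpa [Fin.forall_fin_succ] using h
  have hex : ∀ u v : Fin 5, ∃ i k y z, i ≠ k ∧ y ≠ z ∧ (y ≠ u ∧ y ≠ v) ∧ (z ≠ u ∧ z ≠ v) ∧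
      D.Crosses s(a i, b y) s(a k, b z) := fun u v => by
    obtain ⟨t, ht, htuv⟩ := avoid u v
    obtain ⟨i, j, k, l, hik, hjl, hc⟩ := D.exists_crosses_of_complete ha (hb.comp ht)
      (fun i j => hab i (t j))
    exact ⟨i, k, t j, t l, hik, ht.ne hjl, htuv j, htuv l, hc⟩
  obtain ⟨i₁, k₁, y₁, z₁, hik₁, hyz₁, -, -, hc₁⟩ := hex 0 0
  obtain ⟨i₂, k₂, y₂, z₂, hik₂, hyz₂, hy₂, hz₂, hc₂⟩ := hex y₁ y₁
  obtain ⟨i₃, k₃, y₃, z₃, hik₃, hyz₃, hy₃, hz₃, hc₃⟩ := hex y₁ y₂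
  have h₁₂ := (hD.ne_of_crosses ha hb hne hik₁ hik₂ hy₂.1 hz₂.1 hc₁ hc₂).1
  have h₁₃ := (hD.ne_of_crosses ha hb hne hik₁ hik₃ hy₃.1 hz₃.1 hc₁ hc₃).1
  have h₂₃ := (hD.ne_of_crosses ha hb hne hik₂ hik₃ hy₃.2 hz₃.2 hc₂ hc₃).1
  have hnodup : [y₁, z₁, y₂, z₂, y₃, z₃].Nodup := by
    simp [hyz₁, hyz₂, hyz₃, hy₂.1.symm, hz₂.1.symm, hy₃.1.symm, hz₃.1.symm, hy₃.2.symm,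
      hz₃.2.symm, h₁₂.1.symm, h₁₂.2.symm, h₁₃.1.symm, h₁₃.2.symm, h₂₃.1.symm, h₂₃.2.symm]
  have hle := hnodup.length_le_card
  simp only [List.length_cons, List.length_nil, Fintype.card_fin] at hle
  omega

/-- On seven vertices, an NIC-planar drawing has at most two crossings. -/
theorem IsNICPlanar.eq_or_eq_of_card_eq_seven [Fintype V] (hV : Fintype.card V = 7)
    {D : Drawing G} (hD : D.IsNICPlanar) {e₁ f₁ e₂ f₂ e₃ f₃ : Sym2 V} (h₁ : D.Crosses e₁ f₁)
    (h₂ : D.Crosses e₂ f₂) (h₃ : D.Crosses e₃ f₃)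
    (h₁₂ : ¬ ((e₂ = e₁ ∧ f₂ = f₁) ∨ (e₂ = f₁ ∧ f₂ = e₁))) :
    (e₃ = e₁ ∧ f₃ = f₁) ∨ (e₃ = f₁ ∧ f₃ = e₁) ∨ (e₃ = e₂ ∧ f₃ = f₂) ∨ (e₃ = f₂ ∧ f₃ = e₂) := by
  classical
  by_contra hno
  have card : ∀ {e f}, D.Crosses e f → (e.toFinset ∪ f.toFinset).card = 4 := by
    intro e f h
    have h' := h
    obtain ⟨-, he, hf, -⟩ := h'
    rw [Finset.card_union_of_disjoint,
      Sym2.card_toFinset_of_not_isDiag _ (G.not_isDiag_of_mem_edgeSet he),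
      Sym2.card_toFinset_of_not_isDiag _ (G.not_isDiag_of_mem_edgeSet hf)]
    exact Finset.disjoint_left.2 fun v hv hv' =>
      h.disjoint (Sym2.mem_toFinset.1 hv) (Sym2.mem_toFinset.1 hv')
  have inter : ∀ {e f e' f'}, D.Crosses e f → D.Crosses e' f' →
      ¬ ((e' = e ∧ f' = f) ∨ (e' = f ∧ f' = e)) →
      ((e.toFinset ∪ f.toFinset) ∩ (e'.toFinset ∪ f'.toFinset)).card ≤ 1 := by
    intro e f e' f' h h' hne
    have hle := hD.eq_or_eq_of_crosses h h'
    rw [← or_assoc] at hle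
    refine Finset.card_le_one.2 fun x hx y hy => ?_
    simp only [Finset.mem_inter, Finset.mem_union, Sym2.mem_toFinset] at hx hy
    exact hle.resolve_left hne x y hx.1 hx.2 hy.1 hy.2
  have c₁₂ := inter h₁ h₂ h₁₂
  have c₁₃ := inter h₁ h₃ (by tauto)
  have c₂₃ := inter h₂ h₃ (by tauto)
  have c₁ := card h₁
  have c₂ := card h₂
  have c₃ := card h₃
  set A := e₁.toFinset ∪ f₁.toFinset
  set B := e₂.toFinset ∪ f₂.toFinset
  set C := e₃.toFinset ∪ f₃.toFinset
  have hAB := Finset.card_union_add_card_inter A B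
  have hABC := Finset.card_union_add_card_inter (A ∪ B) C
  have hunion : ((A ∪ B) ∩ C).card ≤ (A ∩ C).card + (B ∩ C).card := by
    rw [Finset.union_inter_distrib_right]
    exact Finset.card_union_le _ _
  have := Finset.card_le_univ (A ∪ B ∪ C)
  omega

end Drawing

theorem not_nicPlanar_K35 : ¬ (completeMultipartite ![3, 5]).NICPlanar := by
  rintro ⟨D, hD⟩
  refine D.not_isNICPlanar_of_K35 (a := fun i => ⟨0, i⟩) (b := fun j => ⟨1, j⟩)
    (sigma_mk_injective (β := fun i => Fin (![3, 5] i)) (i := 0))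
    (sigma_mk_injective (β := fun i => Fin (![3, 5] i)) (i := 1)) (fun i j => ?_) hD
  simp

/-- The other vertex in the part of size two containing `u`. -/
def mate (u : Fin 4) : Fin 4 := ![1, 0, 3, 2] u

/-- Labels for the vertices of `K_{2,2,3}`: the parts of size two are `{0, 1}` and `{2, 3}`. -/
def low (u : Fin 4) : Fin 7 := ⟨u, by omega⟩

/-- Labels for the vertices of `K_{2,2,3}`: the part of size three is `{4, 5, 6}`. -/
def top (i : Fin 3) : Fin 7 := ⟨i + 4, by omega⟩

/-- Branch vertices on one side of a subdivision of `K_{3,3}` in `K_{2,2,3}`. -/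
def leftBranch (u : Fin 4) : Fin 3 → Fin 7 :=
  ![low (mate u), low (u + 2), low (mate (u + 2))]

/-- Branch vertices on the other side of a subdivision of `K_{3,3}` in `K_{2,2,3}`. -/
def rightBranch (u : Fin 4) (l : Fin 3) : Fin 3 → Fin 7 :=
  ![low u, top (l + 1), top (l + 2)]

/-- The path between the branch vertices `mate u` and `u` is subdivided by the vertex `top l`. -/
def subdividing (u : Fin 4) (l : Fin 3) (i j : Fin 3) : Fin 7 :=
  if i = 0 ∧ j = 0 then top l else leftBranch u i

/-- The edges between the parts of sizes three and four that are used by the subdivision of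
`K_{3,3}` given by `u` and `l`. -/
def IsUsed (u : Fin 4) (l : Fin 3) (i : Fin 3) (y : Fin 4) : Prop :=
  (y = u → i = l) ∧ (y = u ∨ y = mate u ∨ i ≠ l)

instance (u l i y) : Decidable (IsUsed u l i y) := by unfold IsUsed; infer_instance

theorem isUsed_of_eq : ∀ u l s t i y,
    (s(leftBranch u s, subdividing u l s t) = s(top i, low y) ∨
      s(subdividing u l s t, rightBranch u l t) = s(top i, low y)) →
    IsUsed u l i y ∧ ((y = u ∨ y = mate u) → s = 0) := by
  decide +kernel

/-- Two edges between the parts of sizes three and four that may lie on vertex-disjoint paths in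
the subdivision of `K_{3,3}` given by `u` and `l`. -/
def IsUsedPair (u : Fin 4) (l : Fin 3) (i k : Fin 3) (y z : Fin 4) : Prop :=
  IsUsed u l i y ∧ IsUsed u l k z ∧ ¬ ((y = u ∨ y = mate u) ∧ (z = u ∨ z = mate u))

instance (u l i k y z) : Decidable (IsUsedPair u l i k y z) := by
  unfold IsUsedPair; infer_instance

set_option synthInstance.maxSize 1000 in
set_option synthInstance.maxHeartbeats 400000 in
/-- For any two pairs of edges that can cross in an NIC-planar drawing of `K_{3,4}`, there is a
subdivision of `K_{3,3}` in `K_{2,2,3}` in which neither pair belongs to vertex-disjoint paths. -/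
theorem exists_not_isUsedPair : ∀ i k : Fin 3, i ≠ k → ∀ y z : Fin 4, y ≠ z →
    ∀ i' k' : Fin 3, i' ≠ k' → ¬ ((i = i' ∨ i = k') ∧ (k = i' ∨ k = k')) →
    ∀ y' z' : Fin 4, y' ≠ z' → y' ≠ y → z' ≠ y → y' ≠ z → z' ≠ z →
    ∃ u l, ¬ IsUsedPair u l i k y z ∧ ¬ IsUsedPair u l i' k' y' z' := by
  decide +kernel

/-- The part of `K_{2,2,3}` containing a given label. -/
def block : Fin 7 → Fin 3 := ![0, 0, 1, 1, 2, 2, 2]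

theorem block_low_ne_block_top : ∀ i y, block (top i) ≠ block (low y) := by decide

theorem block_subdividing : ∀ u l s t,
    (subdividing u l s t = leftBranch u s ∨
      block (leftBranch u s) ≠ block (subdividing u l s t)) ∧
    block (subdividing u l s t) ≠ block (rightBranch u l t) := by decide

theorem paths_disjoint : ∀ u l, ∀ s s', s ≠ s' → ∀ t t', t ≠ t' → ∀ x,
    (x = leftBranch u s ∨ x = subdividing u l s t ∨ x = rightBranch u l t) →
    ¬ (x = leftBranch u s' ∨ x = subdividing u l s' t' ∨ x = rightBranch u l t') := by
  decide +kernel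

theorem low_injective : Function.Injective low := by decide

theorem top_injective : Function.Injective top := by decide

theorem low_ne_top : ∀ y i, low y ≠ top i := by decide

namespace Drawing

variable {V : Type*} {G : SimpleGraph V}

/-- In an NIC-planar drawing of `K_{2,2,3}` there would be two crossings within the spanning
`K_{3,4}` and no others, so that some subdivision of `K_{3,3}` would be drawn without crossings of
vertex-disjoint paths. -/
theorem not_isNICPlanar_of_K223 [Fintype V] (hV : Fintype.card V = 7) (D : Drawing G)
    {φ : Fin 7 → V} (hφ : Function.Injective φ)
    (hadj : ∀ a b, block a ≠ block b → G.Adj (φ a) (φ b)) : ¬ D.IsNICPlanar := by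
  intro hD
  have ha : Function.Injective fun i => φ (top i) := hφ.comp top_injective
  have hb : Function.Injective fun y => φ (low y) := hφ.comp low_injective
  have hab : ∀ i y, G.Adj (φ (top i)) (φ (low y)) := fun i y =>
    hadj _ _ (block_low_ne_block_top i y)
  have hne : ∀ i y, φ (top i) ≠ φ (low y) := fun i y => (hab i y).ne
  have hex : ∀ x : Fin 4, ∃ i k y z, i ≠ k ∧ y ≠ z ∧ y ≠ x ∧ z ≠ x ∧
      D.Crosses s(φ (top i), φ (low y)) s(φ (top k), φ (low z)) := fun x => by
    obtain ⟨i, j, k, l, hik, hjl, hc⟩ := D.exists_crosses_of_complete ha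
      (hb.comp x.succAbove_right_injective) (fun i j => hab i (x.succAbove j))
    exact ⟨i, k, _, _, hik, x.succAbove_right_injective.ne hjl, x.succAbove_ne j,
      x.succAbove_ne l, hc⟩
  obtain ⟨i, k, y, z, hik, hyz, -, -, hc⟩ := hex 0
  obtain ⟨i', k', y', z', hik', hyz', hy', hz', hc'⟩ := hex y
  obtain ⟨hyz'', hpair⟩ := hD.ne_of_crosses ha hb hne hik hik' hy' hz' hc hc'
  obtain ⟨u, l, hu, hu'⟩ := exists_not_isUsedPair i k hik y z hyz i' k' hik' hpair y' z' hyz'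
    hy' hz' hyz''.1 hyz''.2
  obtain ⟨s, t, s', t', hs, ht, e, f, he, hf, hef⟩ := D.exists_crosses_of_K33
    (p := φ ∘ leftBranch u) (q := φ ∘ rightBranch u l) (r := fun s t => φ (subdividing u l s t))
    (fun s t => (block_subdividing u l s t).1.imp (congrArg φ) (hadj _ _))
    (fun s t => hadj _ _ (block_subdividing u l s t).2)
    (fun s t s' t' hs ht x hx hx' => by
      have key := paths_disjoint u l s s' hs t t' ht
      obtain ⟨w, rfl⟩ : ∃ w, x = φ w := by
        rcases hx with rfl | rfl | rfl <;> exact ⟨_, rfl⟩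
      simp only [Function.comp_apply, hφ.eq_iff] at hx hx'
      exact key w hx hx')
  have used : ∀ {e s t i y}, (e = s(φ (leftBranch u s), φ (subdividing u l s t)) ∨
      e = s(φ (subdividing u l s t), φ (rightBranch u l t))) → e = s(φ (top i), φ (low y)) →
      IsUsed u l i y ∧ ((y = u ∨ y = mate u) → s = 0) := by
    intro e s t i y he hey
    refine isUsed_of_eq u l s t i y ?_
    rw [hey] at he
    simpa [hφ.eq_iff, eq_comm] using he
  have absurd_pair : ∀ {i k y z s t s' t' e f}, s ≠ s' → ¬ IsUsedPair u l i k y z →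
      (e = s(φ (leftBranch u s), φ (subdividing u l s t)) ∨
        e = s(φ (subdividing u l s t), φ (rightBranch u l t))) →
      (f = s(φ (leftBranch u s'), φ (subdividing u l s' t')) ∨
        f = s(φ (subdividing u l s' t'), φ (rightBranch u l t'))) →
      e = s(φ (top i), φ (low y)) → f = s(φ (top k), φ (low z)) → False := by
    intro i k y z s t s' t' e f hs hu he hf hey hfz
    have h₁ := used he hey
    have h₂ := used hf hfz
    exact hu ⟨h₁.1, h₂.1, fun h => hs ((h₁.2 h.1).trans (h₂.2 h.2).symm)⟩
  have hdistinct : ¬ ((s(φ (top i'), φ (low y')) = s(φ (top i), φ (low y)) ∧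
      s(φ (top k'), φ (low z')) = s(φ (top k), φ (low z))) ∨
      (s(φ (top i'), φ (low y')) = s(φ (top k), φ (low z)) ∧
      s(φ (top k'), φ (low z')) = s(φ (top i), φ (low y)))) := by
    simp [hφ.eq_iff, low_injective.eq_iff, low_ne_top, (low_ne_top _ _).symm, hy', hz']
  rcases hD.eq_or_eq_of_card_eq_seven hV hc hc' hef hdistinct with h | h | h | h
  · exact absurd_pair hs hu he hf h.1 h.2
  · exact absurd_pair hs.symm hu hf he h.2 h.1
  · exact absurd_pair hs hu' he hf h.1 h.2
  · exact absurd_pair hs.symm hu' hf he h.2 h.1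

end Drawing

/-- The vertices of `K_{2,2,3}`, listed part by part. -/
def vertexK223 : Fin 7 → Σ i : Fin 3, Fin ((![2, 2, 3] : Fin 3 → ℕ) i) :=
  ![⟨0, 0, by decide⟩, ⟨0, 1, by decide⟩, ⟨1, 0, by decide⟩, ⟨1, 1, by decide⟩,
    ⟨2, 0, by decide⟩, ⟨2, 1, by decide⟩, ⟨2, 2, by decide⟩]

theorem not_nicPlanar_K223 : ¬ (completeMultipartite ![2, 2, 3]).NICPlanar := by
  rintro ⟨D, hD⟩
  have hfst : ∀ a, (vertexK223 a).1 = block a := by decide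
  refine D.not_isNICPlanar_of_K223 (by decide) (φ := vertexK223) (by decide) (fun a b h => ?_) hD
  simpa [hfst] using h

/-- Two sets properly cross at `x` if, in a parallelogram centred at `x`, they agree with the two
lines through `x` parallel to the sides. -/
theorem properCross_of_basis {A B : Set (ℝ × ℝ)} {x u v : ℝ × ℝ}
    (huv : u.1 * v.2 - u.2 * v.1 ≠ 0)
    (hA : ∀ α β : ℝ, |α| < 1 → |β| < 1 → (x + α • u + β • v ∈ A ↔ β = 0))
    (hB : ∀ α β : ℝ, |α| < 1 → |β| < 1 → (x + α • u + β • v ∈ B ↔ α = 0)) :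
    ProperCross A B x := by
  let a : ℝ × ℝ → ℝ := fun y => ((y.1 - x.1) * v.2 - (y.2 - x.2) * v.1) / (u.1 * v.2 - u.2 * v.1)
  let b : ℝ × ℝ → ℝ := fun y => (u.1 * (y.2 - x.2) - u.2 * (y.1 - x.1)) / (u.1 * v.2 - u.2 * v.1)
  let k : ℝ → ℝ := fun r => r / (1 + |r|)
  let h : ℝ → ℝ := fun r => r / (1 - |r|)
  have ha : Continuous a := by fun_prop
  have hb : Continuous b := by fun_prop
  have hk : Continuous k := continuous_id.div₀ (by fun_prop) fun r => by positivity
  have hk1 : ∀ r, |k r| < 1 := fun r => by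
    rw [abs_div, abs_of_pos (by positivity : 0 < 1 + |r|), div_lt_one (by positivity)]
    linarith
  have hkh : ∀ r, |r| < 1 → k (h r) = r := fun r hr => by
    have : 0 < 1 - |r| := by linarith
    simp only [k, h, abs_div, abs_of_pos this]
    field_simp
    ring
  have hhk : ∀ r, h (k r) = r := fun r => by
    have : 0 < 1 + |r| := by positivity
    simp only [k, h, abs_div, abs_of_pos this]
    field_simp
    ring
  have ha' : ∀ α β : ℝ, a (x + α • u + β • v) = α := fun α β => by
    simp only [a, Prod.fst_add, Prod.snd_add, Prod.smul_fst, Prod.smul_snd, smul_eq_mul]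
    rw [div_eq_iff huv]
    ring
  have hb' : ∀ α β : ℝ, b (x + α • u + β • v) = β := fun α β => by
    simp only [b, Prod.fst_add, Prod.snd_add, Prod.smul_fst, Prod.smul_snd, smul_eq_mul]
    rw [div_eq_iff huv]
    ring
  have hab : ∀ y, x + a y • u + b y • v = y := fun y => by
    have h₁ := div_mul_cancel₀ ((y.1 - x.1) * v.2 - (y.2 - x.2) * v.1) huv
    have h₂ := div_mul_cancel₀ (u.1 * (y.2 - x.2) - u.2 * (y.1 - x.1)) huv
    ext <;> refine mul_left_cancel₀ huv ?_
    · simp only [a, b, Prod.fst_add, Prod.smul_fst, smul_eq_mul]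
      linear_combination u.1 * h₁ + v.1 * h₂
    · simp only [a, b, Prod.snd_add, Prod.smul_snd, smul_eq_mul]
      linear_combination u.2 * h₁ + v.2 * h₂
  have hx : a x = 0 ∧ b x = 0 := by simp [a, b]
  let U : Set (ℝ × ℝ) := {y | |a y| < 1 ∧ |b y| < 1}
  let φ : U ≃ₜ (ℝ × ℝ) :=
    { toFun := fun y => (h (a y), h (b y))
      invFun := fun q => ⟨x + k q.1 • u + k q.2 • v, by
        simp only [U, mem_ofPred_eq, ha', hb']
        exact ⟨hk1 _, hk1 _⟩⟩
      left_inv := fun y => by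
        ext1
        simp only [hkh _ y.2.1, hkh _ y.2.2, hab]
      right_inv := fun q => by simp only [ha', hb', hhk]
      continuous_toFun := by
        refine Continuous.prodMk ?_ ?_
        · exact (ha.comp continuous_subtype_val).div₀
            (continuous_const.sub (ha.comp continuous_subtype_val).abs)
            fun y => (sub_pos.2 y.2.1).ne'
        · exact (hb.comp continuous_subtype_val).div₀
            (continuous_const.sub (hb.comp continuous_subtype_val).abs)
            fun y => (sub_pos.2 y.2.2).ne'
      continuous_invFun := by
        refine Continuous.subtype_mk ?_ _
        have h₁ := hk.comp (continuous_fst (X := ℝ) (Y := ℝ))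
        have h₂ := hk.comp (continuous_snd (X := ℝ) (Y := ℝ))
        exact (continuous_const.add (h₁.smul continuous_const)).add (h₂.smul continuous_const) }
  have image : ∀ (C : Set (ℝ × ℝ)), (fun y => φ y) '' {y : U | (y : ℝ × ℝ) ∈ C} =
      {q | x + k q.1 • u + k q.2 • v ∈ C} := fun C => by
    ext q
    constructor
    · rintro ⟨y, hy, rfl⟩
      change ((φ.symm (φ y) : U) : ℝ × ℝ) ∈ C
      rwa [φ.symm_apply_apply]
    · intro hq
      exact ⟨φ.symm q, hq, φ.apply_symm_apply q⟩
  have hk0 : ∀ r, k r = 0 ↔ r = 0 := fun r => by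
    have : 1 + |r| ≠ 0 := by positivity
    simp [k, this]
  refine ⟨U, ?_, ?_, φ, ?_, ?_, ?_⟩
  · exact (isOpen_lt ha.abs continuous_const).inter (isOpen_lt hb.abs continuous_const)
  · simp [U, hx]
  · change (h (a x), h (b x)) = (0, 0)
    simp [hx, h]
  · rw [image]
    ext q
    simp only [mem_ofPred_eq, hA _ _ (hk1 _) (hk1 _), hk0]
  · rw [image]
    ext q
    simp only [mem_ofPred_eq, hB _ _ (hk1 _) (hk1 _), hk0]

/-- Twice the signed area of the triangle `a b c`. -/
def signedArea {R : Type*} [CommRing R] (a b c : R × R) : R :=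
  (b.1 - a.1) * (c.2 - a.2) - (b.2 - a.2) * (c.1 - a.1)

/-- Points of the line through `a` and `b`, in terms of a parameter. -/
theorem signedArea_lineMap (a b c d : ℝ × ℝ) (t : ℝ) :
    signedArea a b (AffineMap.lineMap c d t) =
      (1 - t) * signedArea a b c + t * signedArea a b d := by
  simp only [signedArea, AffineMap.lineMap_apply, vsub_eq_sub, vadd_eq_add, Prod.fst_add,
    Prod.snd_add, Prod.smul_fst, Prod.smul_snd, Prod.fst_sub, Prod.snd_sub, smul_eq_mul]
  ring

theorem signedArea_lineMap_self (a b : ℝ × ℝ) (t : ℝ) :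
    signedArea a b (AffineMap.lineMap a b t) = 0 := by
  rw [signedArea_lineMap]
  simp only [signedArea]
  ring

theorem mem_segment_iff_lineMap {a b x : ℝ × ℝ} :
    x ∈ segment ℝ a b ↔ ∃ t ∈ Icc (0 : ℝ) 1, AffineMap.lineMap a b t = x := by
  rw [segment_eq_image_lineMap]
  rfl

theorem properCross_segment_s18 {a b c d x : ℝ × ℝ} (hc : signedArea a b c ≠ 0)
    (hxab : x ∈ segment ℝ a b) (hxcd : x ∈ segment ℝ c d) (hxa : x ≠ a) (hxb : x ≠ b)
    (hxc : x ≠ c) (hxd : x ≠ d) : ProperCross (segment ℝ a b) (segment ℝ c d) x := by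
  obtain ⟨s, ⟨hs0, hs1⟩, rfl⟩ := mem_segment_iff_lineMap.1 hxab
  obtain ⟨t, ⟨ht0, ht1⟩, hst⟩ := mem_segment_iff_lineMap.1 hxcd
  have hs0 : 0 < s := hs0.lt_of_ne (by rintro rfl; simp at hxa)
  have hs1 : s < 1 := hs1.lt_of_ne (by rintro rfl; simp at hxb)
  have ht0 : 0 < t := ht0.lt_of_ne (by rintro rfl; simp [← hst] at hxc)
  have ht1 : t < 1 := ht1.lt_of_ne (by rintro rfl; simp [← hst] at hxd)
  obtain ⟨ε, hε, hεs, hεs', hεt, hεt'⟩ : ∃ ε : ℝ, 0 < ε ∧ ε ≤ s ∧ ε ≤ 1 - s ∧ ε ≤ t ∧ ε ≤ 1 - t :=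
    ⟨min (min s (1 - s)) (min t (1 - t)), by simp [*], by simp, by simp, by simp, by simp⟩
  have hdet : (b.1 - a.1) * (d.2 - c.2) - (b.2 - a.2) * (d.1 - c.1) ≠ 0 := fun h => by
    have h₁ := signedArea_lineMap a b c d t
    rw [hst, signedArea_lineMap_self] at h₁
    refine hc ?_
    simp only [signedArea] at h₁ ⊢
    linear_combination -t * h - h₁
  have hst1 := congrArg Prod.fst hst
  have hst2 := congrArg Prod.snd hst
  simp only [AffineMap.lineMap_apply, vsub_eq_sub, vadd_eq_add, Prod.fst_add,
    Prod.snd_add, Prod.smul_fst, Prod.smul_snd, Prod.fst_sub, Prod.snd_sub, smul_eq_mul]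
    at hst1 hst2
  have bound : ∀ α : ℝ, |α| < 1 → -ε ≤ α * ε ∧ α * ε ≤ ε := fun α hα => by
    rw [abs_lt] at hα
    constructor <;> nlinarith
  refine properCross_of_basis (u := ε • (b - a)) (v := ε • (d - c)) ?_ ?_ ?_
  · have : (ε • (b - a)).1 * (ε • (d - c)).2 - (ε • (b - a)).2 * (ε • (d - c)).1 =
        ε ^ 2 * ((b.1 - a.1) * (d.2 - c.2) - (b.2 - a.2) * (d.1 - c.1)) := by
      simp
      ring
    rw [this]
    exact mul_ne_zero (by positivity) hdet
  · intro α β hα hβ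
    rw [mem_segment_iff_lineMap]
    constructor
    · rintro ⟨τ, -, hτ⟩
      have h := signedArea_lineMap_self a b τ
      rw [hτ] at h
      have h' := signedArea_lineMap_self a b s
      simp only [signedArea, Prod.fst_add, Prod.snd_add, Prod.smul_fst, Prod.smul_snd,
        Prod.fst_sub, Prod.snd_sub, smul_eq_mul] at h h'
      have : β * (ε * ((b.1 - a.1) * (d.2 - c.2) - (b.2 - a.2) * (d.1 - c.1))) = 0 := by
        linear_combination h - h'
      exact (mul_eq_zero.1 this).resolve_right (mul_ne_zero hε.ne' hdet)
    · rintro rfl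
      refine ⟨s + α * ε, ⟨by linarith [bound α hα], by linarith [bound α hα]⟩, ?_⟩
      ext <;> simp [AffineMap.lineMap_apply] <;> ring
  · intro α β hα hβ
    rw [mem_segment_iff_lineMap, ← hst]
    constructor
    · rintro ⟨τ, -, hτ⟩
      have h := signedArea_lineMap_self c d τ
      rw [hτ] at h
      have h' := signedArea_lineMap_self c d t
      simp only [signedArea, Prod.fst_add, Prod.snd_add, Prod.smul_fst, Prod.smul_snd,
        Prod.fst_sub, Prod.snd_sub, smul_eq_mul] at h h'
      have : α * (ε * ((b.1 - a.1) * (d.2 - c.2) - (b.2 - a.2) * (d.1 - c.1))) = 0 := by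
        linear_combination h' - h
      exact (mul_eq_zero.1 this).resolve_right (mul_ne_zero hε.ne' hdet)
    · rintro rfl
      refine ⟨t + β * ε, ⟨by linarith [bound β hβ], by linarith [bound β hβ]⟩, ?_⟩
      ext <;> simp [AffineMap.lineMap_apply] <;> ring

section StraightLine

variable {V : Type*} {pos : V → ℝ × ℝ}

/-- No three of the points `pos v` are collinear. -/
def GeneralPosition (pos : V → ℝ × ℝ) : Prop :=
  ∀ u v w, u ≠ v → u ≠ w → v ≠ w → signedArea (pos u) (pos v) (pos w) ≠ 0

/-- The straight-line arc for a pair of vertices. -/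
noncomputable def edgeArc (pos : V → ℝ × ℝ) (e : Sym2 V) : ℝ → ℝ × ℝ :=
  AffineMap.lineMap (pos (Quot.out e).1) (pos (Quot.out e).2)

theorem mk_out (e : Sym2 V) : s((Quot.out e).1, (Quot.out e).2) = e := Quot.out_eq e

theorem image_edgeArc (pos : V → ℝ × ℝ) (a b : V) :
    edgeArc pos s(a, b) '' Icc 0 1 = segment ℝ (pos a) (pos b) := by
  rw [edgeArc, ← segment_eq_image_lineMap]
  rcases Sym2.eq_iff.1 (mk_out s(a, b)) with h | h
  · rw [h.1, h.2]
  · rw [h.1, h.2, segment_symm]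

theorem GeneralPosition.notMem_segment (h : GeneralPosition pos) {a b v : V} (hab : a ≠ b)
    (hva : v ≠ a) (hvb : v ≠ b) : pos v ∉ segment ℝ (pos a) (pos b) := fun hv => by
  obtain ⟨t, -, ht⟩ := mem_segment_iff_lineMap.1 hv
  refine h a b v hab hva.symm hvb.symm ?_
  rw [← ht, signedArea_lineMap_self]

theorem GeneralPosition.segment_inter_subset_of_ne (h : GeneralPosition pos) {v b c : V}
    (hvb : v ≠ b) (hvc : v ≠ c) (hbc : b ≠ c) :
    segment ℝ (pos v) (pos b) ∩ segment ℝ (pos v) (pos c) ⊆ {pos v} := by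
  rintro x ⟨hx, hx'⟩
  obtain ⟨s, -, hs⟩ := mem_segment_iff_lineMap.1 hx
  obtain ⟨t, -, ht⟩ := mem_segment_iff_lineMap.1 hx'
  have h₁ := signedArea_lineMap_self (pos v) (pos b) s
  rw [hs, ← ht, signedArea_lineMap] at h₁
  have h₂ : signedArea (pos v) (pos b) (pos v) = 0 := by
    simp only [signedArea]
    ring
  rw [h₂, mul_zero, zero_add] at h₁
  have h₃ : t = 0 := (mul_eq_zero.1 h₁).resolve_right (h v b c hvb hvc hbc)
  rw [← ht, h₃, AffineMap.lineMap_apply_zero]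
  rfl

theorem GeneralPosition.segment_inter_subsingleton (h : GeneralPosition pos) {a b c d : V}
    (hab : a ≠ b) (hac : a ≠ c) (hbc : b ≠ c) :
    (segment ℝ (pos a) (pos b) ∩ segment ℝ (pos c) (pos d)).Subsingleton := by
  rintro x ⟨hx, hx'⟩ y ⟨hy, hy'⟩
  obtain ⟨s, -, hs⟩ := mem_segment_iff_lineMap.1 hx
  obtain ⟨t, -, ht⟩ := mem_segment_iff_lineMap.1 hx'
  obtain ⟨s', -, hs'⟩ := mem_segment_iff_lineMap.1 hy
  obtain ⟨t', -, ht'⟩ := mem_segment_iff_lineMap.1 hy'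
  have h₁ := signedArea_lineMap_self (pos a) (pos b) s
  rw [hs, ← ht, signedArea_lineMap] at h₁
  have h₂ := signedArea_lineMap_self (pos a) (pos b) s'
  rw [hs', ← ht', signedArea_lineMap] at h₂
  have h₃ : (t' - t) * signedArea (pos a) (pos b) (pos c) = 0 := by
    linear_combination t' * h₁ - t * h₂
  have h₄ := (mul_eq_zero.1 h₃).resolve_right (h a b c hab hac hbc)
  rw [← ht, ← ht', sub_eq_zero.1 h₄]

theorem mul_neg_of_mem_segment {a b c d x : ℝ × ℝ} (hc : signedArea a b c ≠ 0)
    (hd : signedArea a b d ≠ 0) (hx : x ∈ segment ℝ a b) (hx' : x ∈ segment ℝ c d) :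
    signedArea a b c * signedArea a b d < 0 := by
  obtain ⟨s, -, hs⟩ := mem_segment_iff_lineMap.1 hx
  obtain ⟨t, ⟨ht0, ht1⟩, ht⟩ := mem_segment_iff_lineMap.1 hx'
  have h := signedArea_lineMap_self a b s
  rw [hs, ← ht, signedArea_lineMap] at h
  by_contra! hpos
  have hpos := hpos.lt_of_ne (mul_ne_zero hc hd).symm
  have h₁ : (1 - t) * signedArea a b c ^ 2 +
      t * (signedArea a b c * signedArea a b d) = 0 := by
    linear_combination signedArea a b c * h
  have hc2 : 0 < signedArea a b c ^ 2 := by positivity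
  nlinarith [mul_nonneg ht0 hpos.le, mul_nonneg (sub_nonneg.2 ht1) hc2.le]

theorem GeneralPosition.segment_inter_subset (h : GeneralPosition pos)
    {G : SimpleGraph V} {e f : Sym2 V} (he : e ∈ G.edgeSet) (hf : f ∈ G.edgeSet) (hef : e ≠ f)
    {v : V} (hve : v ∈ e) (hvf : v ∈ f) :
    edgeArc pos e '' Icc 0 1 ∩ edgeArc pos f '' Icc 0 1 ⊆ {pos v} := by
  obtain ⟨b, rfl⟩ := hve
  obtain ⟨c, rfl⟩ := hvf
  rw [image_edgeArc, image_edgeArc]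
  exact h.segment_inter_subset_of_ne (G.ne_of_adj he) (G.ne_of_adj hf) (by rintro rfl; simp at hef)

theorem GeneralPosition.disjoint_of_mem (h : GeneralPosition pos)
    {G : SimpleGraph V} {e f : Sym2 V} (he : e ∈ G.edgeSet) (hf : f ∈ G.edgeSet) (hef : e ≠ f)
    {x : ℝ × ℝ} (hx : x ∉ range pos) (hxe : x ∈ edgeArc pos e '' Icc 0 1)
    (hxf : x ∈ edgeArc pos f '' Icc 0 1) {v : V} (hve : v ∈ e) : v ∉ f := fun hvf =>
  hx ⟨v, (h.segment_inter_subset he hf hef hve hvf ⟨hxe, hxf⟩).symm⟩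

/-- A relation that holds for any two straight-line edges satisfying the sign condition for
crossing holds for any two edges that cross. -/
theorem GeneralPosition.rel_of_mem (h : GeneralPosition pos) {G : SimpleGraph V}
    {R : Sym2 V → Sym2 V → Prop}
    (hR : ∀ a b c d, G.Adj a b → G.Adj c d →
      signedArea (pos a) (pos b) (pos c) * signedArea (pos a) (pos b) (pos d) < 0 →
      signedArea (pos c) (pos d) (pos a) * signedArea (pos c) (pos d) (pos b) < 0 →
      R s(a, b) s(c, d)) {e f : Sym2 V} (he : e ∈ G.edgeSet) (hf : f ∈ G.edgeSet) (hef : e ≠ f)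
    {x : ℝ × ℝ} (hx : x ∉ range pos) (hxe : x ∈ edgeArc pos e '' Icc 0 1)
    (hxf : x ∈ edgeArc pos f '' Icc 0 1) : R e f := by
  have hdisj := fun v => h.disjoint_of_mem he hf hef hx hxe hxf (v := v)
  induction e with | _ a b
  induction f with | _ c d
  have hab : a ≠ b := G.ne_of_adj he
  have hcd : c ≠ d := G.ne_of_adj hf
  simp only [Sym2.mem_iff, forall_eq_or_imp, forall_eq, not_or] at hdisj
  obtain ⟨⟨hac, had⟩, hbc, hbd⟩ := hdisj
  rw [image_edgeArc] at hxe hxf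
  exact hR a b c d he hf
    (mul_neg_of_mem_segment (h a b c hab hac hbc) (h a b d hab had hbd) hxe hxf)
    (mul_neg_of_mem_segment (h c d a hcd (Ne.symm hac) (Ne.symm had))
      (h c d b hcd (Ne.symm hbc) (Ne.symm hbd)) hxf hxe)

/-- The straight-line drawing with vertices in general position, if each edge is crossed by at
most one other edge. -/
noncomputable def Drawing.straightLine (G : SimpleGraph V) (hinj : Function.Injective pos)
    (h : GeneralPosition pos) {R : Sym2 V → Sym2 V → Prop}
    (hR : ∀ a b c d, G.Adj a b → G.Adj c d →
      signedArea (pos a) (pos b) (pos c) * signedArea (pos a) (pos b) (pos d) < 0 →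
      signedArea (pos c) (pos d) (pos a) * signedArea (pos c) (pos d) (pos b) < 0 →
      R s(a, b) s(c, d)) (hR' : ∀ e f f', R e f → R e f' → f = f') : Drawing G where
  pos := pos
  pos_inj := hinj
  arc e := edgeArc pos e
  arc_cont e := (AffineMap.lineMap_continuous).continuousOn
  arc_inj e := by
    refine (AffineMap.lineMap_injective ℝ (hinj.ne ?_)).injOn
    have := e.2
    rw [← mk_out e.1] at this
    exact G.ne_of_adj this
  arc_ends e := ⟨_, _, (mk_out e.1).symm, by simp [edgeArc], by simp [edgeArc]⟩
  no_vertex_interior := by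
    rintro ⟨e, he⟩ v hv
    induction e with | _ a b
    simp only [Sym2.mem_iff, not_or] at hv
    rw [image_edgeArc]
    exact h.notMem_segment (G.ne_of_adj he) hv.1 hv.2
  shared_endpoint e f hef v hve hvf :=
    h.segment_inter_subset e.2 f.2 (by rwa [Ne, ← Subtype.ext_iff]) hve hvf
  finite_meet := by
    rintro ⟨e, he⟩ ⟨f, hf⟩ hef
    replace hef : e ≠ f := by simpa using hef
    by_cases hv : ∃ v, v ∈ e ∧ v ∈ f
    · obtain ⟨v, hve, hvf⟩ := hv
      exact (Set.finite_singleton _).subset (h.segment_inter_subset he hf hef hve hvf)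
    · induction e with | _ a b
      induction f with | _ c d
      simp only [Sym2.mem_iff, not_exists, not_and, not_or, forall_eq_or_imp, forall_eq] at hv
      simp only [image_edgeArc]
      exact (h.segment_inter_subsingleton (G.ne_of_adj he) hv.1.1 hv.2.1).finite
  proper := by
    rintro ⟨e, he⟩ ⟨f, hf⟩ hef x ⟨hxe, hxf⟩ hx
    replace hef : e ≠ f := by simpa using hef
    have hdisj := fun v => h.disjoint_of_mem he hf hef hx hxe hxf (v := v)
    induction e with | _ a b
    induction f with | _ c d
    simp only [Sym2.mem_iff, forall_eq_or_imp, forall_eq, not_or] at hdisj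
    simp only [image_edgeArc] at hxe hxf ⊢
    have hne : ∀ v, x ≠ pos v := fun v hv => hx ⟨v, hv.symm⟩
    exact properCross_segment_s18 (h a b c (G.ne_of_adj he) hdisj.1.1 hdisj.2.1) hxe hxf (hne a)
      (hne b) (hne c) (hne d)
  at_most_two := by
    rintro x hx ⟨e₁, he₁⟩ ⟨e₂, he₂⟩ ⟨e₃, he₃⟩ h₁ h₂ h₃
    simp only [Subtype.mk.injEq]
    by_contra! hne
    exact hne.2.2 (hR' _ _ _ (h.rel_of_mem hR he₁ he₂ hne.1 hx h₁ h₂)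
      (h.rel_of_mem hR he₁ he₃ hne.2.1 hx h₁ h₃))

theorem nicPlanar_of_straightLine (G : SimpleGraph V) (hinj : Function.Injective pos)
    (h : GeneralPosition pos) {R : Sym2 V → Sym2 V → Prop}
    (hR : ∀ a b c d, G.Adj a b → G.Adj c d →
      signedArea (pos a) (pos b) (pos c) * signedArea (pos a) (pos b) (pos d) < 0 →
      signedArea (pos c) (pos d) (pos a) * signedArea (pos c) (pos d) (pos b) < 0 →
      R s(a, b) s(c, d)) (hR' : ∀ e f f', R e f → R e f' → f = f')
    (hR'' : ∀ e f e' f', R e f → R e' f' → e' = e ∨ e' = f ∨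
      ∀ x y, (x ∈ e ∨ x ∈ f) → (x ∈ e' ∨ x ∈ f') → (y ∈ e ∨ y ∈ f) → (y ∈ e' ∨ y ∈ f') →
        x = y) : G.NICPlanar := by
  let D := Drawing.straightLine G hinj h hR hR'
  have arcIm : ∀ e : G.edgeSet, D.arcIm e = edgeArc pos e '' Icc 0 1 := fun e => rfl
  have rel : ∀ {e f : G.edgeSet} {x}, e ≠ f → x ∉ range pos → x ∈ D.arcIm e → x ∈ D.arcIm f →
      R e f := fun hef hx hxe hxf =>
    h.rel_of_mem hR (Subtype.prop _) (Subtype.prop _) (fun hh => hef (Subtype.ext hh)) hx hxe hxf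
  have unique : ∀ {e f f' : G.edgeSet} {x y}, e ≠ f → e ≠ f' → x ∉ range pos → y ∉ range pos →
      x ∈ D.arcIm e → x ∈ D.arcIm f → y ∈ D.arcIm e → y ∈ D.arcIm f' → x = y := by
    intro e f f' x y hef hef' hx hy hxe hxf hye hyf
    obtain rfl : f = f' := Subtype.ext (hR' _ _ _ (rel hef hx hxe hxf) (rel hef' hy hye hyf))
    have hdisj := fun v => h.disjoint_of_mem e.2 f.2 (fun hh => hef (Subtype.ext hh)) hx hxe hxf
      (v := v)
    obtain ⟨e, he⟩ := e
    obtain ⟨f, hf⟩ := f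
    induction e with | _ a b
    induction f with | _ c d
    simp only [Sym2.mem_iff, forall_eq_or_imp, forall_eq, not_or] at hdisj
    simp only [arcIm, image_edgeArc] at hxe hxf hye hyf
    exact h.segment_inter_subsingleton (G.ne_of_adj he) hdisj.1.1 hdisj.2.1 ⟨hxe, hxf⟩ ⟨hye, hyf⟩
  refine ⟨D, ?_, ?_⟩
  · rintro e x ⟨⟨hx, e₁, e₂, h₁₂, hx₁, hx₂⟩, hxe⟩ y ⟨⟨hy, f₁, f₂, h₁₂', hy₁, hy₂⟩, hye⟩
    obtain ⟨f, hef, hxf⟩ : ∃ f, e ≠ f ∧ x ∈ D.arcIm f := by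
      by_cases he : e = e₁
      · exact ⟨e₂, he ▸ h₁₂, hx₂⟩
      · exact ⟨e₁, he, hx₁⟩
    obtain ⟨f', hef', hyf⟩ : ∃ f, e ≠ f ∧ y ∈ D.arcIm f := by
      by_cases he : e = f₁
      · exact ⟨f₂, he ▸ h₁₂', hy₂⟩
      · exact ⟨f₁, he, hy₁⟩
    exact unique hef hef' hx hy hxe hxf hye hyf
  · rintro x ⟨hx, e, f, hef, hxe, hxf⟩ y ⟨hy, e', f', hef', hye, hyf⟩ hxy
    have cluster : ∀ {x} {e f : G.edgeSet}, e ≠ f → x ∉ range pos → x ∈ D.arcIm e →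
        x ∈ D.arcIm f → ∀ v ∈ D.cluster x, v ∈ (e : Sym2 V) ∨ v ∈ (f : Sym2 V) := by
      rintro x e f hef hx hxe hxf v ⟨e', hxe', hv⟩
      rcases D.at_most_two x hx e f e' hxe hxf hxe' with h | h | h
      · exact absurd h hef
      · exact Or.inl (h ▸ hv)
      · exact Or.inr (h ▸ hv)
    rcases hR'' _ _ _ _ (rel hef hx hxe hxf) (rel hef' hy hye hyf) with hh | hh | hh
    · obtain rfl := Subtype.ext hh
      exact absurd (unique hef hef' hx hy hxe hxf hye hyf) hxy
    · obtain rfl := Subtype.ext hh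
      exact absurd (unique hef.symm hef' hx hy hxf hxe hye hyf) hxy
    · have hsub : (D.cluster x ∩ D.cluster y).Subsingleton := fun v hv w hw =>
        hh v w (cluster hef hx hxe hxf v hv.1) (cluster hef' hy hye hyf v hv.2)
          (cluster hef hx hxe hxf w hw.1) (cluster hef' hy hye hyf w hw.2)
      exact (Set.ncard_le_one hsub.finite).2 fun v hv w hw => hsub hv hw

end StraightLine

/-- Integer points that give a straight-line drawing of the graph with adjacency relation `A` whose
only crossings are of `e₁` with `f₁` and of `e₂` with `f₂`, where these two crossings have at most
one common end-vertex. -/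
structure IsGoodPlacement {n : ℕ} (P : Fin n → ℤ × ℤ) (A : Fin n → Fin n → Prop)
    (e₁ f₁ e₂ f₂ : Sym2 (Fin n)) : Prop where
  injective : Function.Injective P
  signedArea_ne_zero : ∀ i j k, i ≠ j → i ≠ k → j ≠ k → signedArea (P i) (P j) (P k) ≠ 0
  crossing : ∀ i j, A i j → ∀ k l, A k l →
    signedArea (P i) (P j) (P k) * signedArea (P i) (P j) (P l) < 0 →
    signedArea (P k) (P l) (P i) * signedArea (P k) (P l) (P j) < 0 →
    (s(i, j) = e₁ ∧ s(k, l) = f₁) ∨ (s(i, j) = f₁ ∧ s(k, l) = e₁) ∨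
      (s(i, j) = e₂ ∧ s(k, l) = f₂) ∨ (s(i, j) = f₂ ∧ s(k, l) = e₂)
  nodup : [e₁, f₁, e₂, f₂].Nodup
  common : ∀ x y, (x ∈ e₁ ∨ x ∈ f₁) → (x ∈ e₂ ∨ x ∈ f₂) → (y ∈ e₁ ∨ y ∈ f₁) →
    (y ∈ e₂ ∨ y ∈ f₂) → x = y

theorem signedArea_cast (a b c : ℤ × ℤ) :
    signedArea ((a.1 : ℝ), (a.2 : ℝ)) ((b.1 : ℝ), (b.2 : ℝ)) ((c.1 : ℝ), (c.2 : ℝ)) =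
      (signedArea a b c : ℤ) := by
  simp [signedArea]

theorem IsGoodPlacement.nicPlanar {n : ℕ} {P : Fin n → ℤ × ℤ} {A : Fin n → Fin n → Prop}
    {e₁ f₁ e₂ f₂ : Sym2 (Fin n)} (hP : IsGoodPlacement P A e₁ f₁ e₂ f₂) {V : Type*}
    {G : SimpleGraph V} {g : V → Fin n} (hg : Function.Injective g)
    (hA : ∀ u v, G.Adj u v → A (g u) (g v)) : G.NICPlanar := by
  obtain ⟨hinj, harea, hcross, hnodup, hcommon⟩ := hP
  simp only [List.nodup_cons, List.mem_cons, List.not_mem_nil, or_false, not_or, not_false_eq_true,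
    List.nodup_nil, and_true] at hnodup
  obtain ⟨⟨h₁, h₂, h₃⟩, ⟨h₄, h₅⟩, h₆⟩ := hnodup
  have hmap := Sym2.map.injective hg
  refine nicPlanar_of_straightLine G (pos := fun v => (((P (g v)).1 : ℝ), ((P (g v)).2 : ℝ)))
    (R := fun e f => (e.map g = e₁ ∧ f.map g = f₁) ∨ (e.map g = f₁ ∧ f.map g = e₁) ∨
      (e.map g = e₂ ∧ f.map g = f₂) ∨ (e.map g = f₂ ∧ f.map g = e₂))
    (fun u v h => ?_) (fun u v w huv huw hvw => ?_) (fun a b c d hab hcd h h' => ?_)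
    (fun e f f' h h' => hmap ?_) (fun e f e' f' h h' => ?_)
  · simp only [Prod.mk.injEq, Int.cast_inj] at h
    exact hg (hinj (Prod.ext h.1 h.2))
  · rw [signedArea_cast, Int.cast_ne_zero]
    exact harea _ _ _ (hg.ne huv) (hg.ne huw) (hg.ne hvw)
  · simp only [signedArea_cast] at h h'
    exact hcross _ _ (hA _ _ hab) _ _ (hA _ _ hcd) (by exact_mod_cast h) (by exact_mod_cast h')
  · rcases h with h | h | h | h <;> rcases h' with h' | h' | h' | h' <;> grind
  · have mem : ∀ {x : V} {e f : Sym2 V}, (x ∈ e ∨ x ∈ f) → (g x ∈ e.map g ∨ g x ∈ f.map g) :=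
      fun hx => hx.imp (fun h => Sym2.mem_map.2 ⟨_, h, rfl⟩) fun h => Sym2.mem_map.2 ⟨_, h, rfl⟩
    rw [← hmap.eq_iff, ← hmap.eq_iff (a := e') (b := f), or_iff_not_imp_left,
      or_iff_not_imp_left]
    intro hne hne' x y hx hx' hy hy'
    replace hx := mem hx
    replace hx' := mem hx'
    replace hy := mem hy
    replace hy' := mem hy'
    refine hg ?_
    rw [← or_assoc] at h h'
    rcases h with h | h <;> rcases h' with h' | h'
    · grind only
    · refine hcommon _ _ ?_ ?_ ?_ ?_ <;> grind only
    · refine hcommon _ _ ?_ ?_ ?_ ?_ <;> grind only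
    · grind only

/-- The part of `K_{3,5}` containing a given label. -/
def blockK35 : Fin 8 → Fin 2 := ![0, 0, 0, 1, 1, 1, 1, 1]

/-- The vertices of `K_{3,5}` labelled part by part. -/
def labelK35 (v : Σ i : Fin 2, Fin ((![3, 5] : Fin 2 → ℕ) i)) : Fin 8 :=
  Fin.ofNat 8 (![0, 3] v.1 + v.2.1)

theorem isGoodPlacement_K35 : IsGoodPlacement
    ![(0, 0), (8, 6), (9, 11), (9, 4), (12, 5), (2, 12), (6, 11), (4, 5)]
    (fun a b => blockK35 a ≠ blockK35 b ∧ s(a, b) ≠ s(2, 7)) s(0, 6) s(1, 5) s(1, 4) s(2, 3) where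
  injective := by decide +kernel
  signedArea_ne_zero := by decide +kernel
  crossing := by decide +kernel
  nodup := by decide +kernel
  common := by
    simp only [Sym2.mem_iff]
    decide +kernel

theorem isGoodPlacement_K223_deleteEdge_1_3 : IsGoodPlacement
    ![(10, 7), (1, 6), (7, 3), (12, 12), (10, 1), (8, 5), (0, 6)]
    (fun a b => block a ≠ block b ∧ s(a, b) ≠ s(1, 3)) s(0, 6) s(3, 5) s(1, 4) s(2, 6) where
  injective := by decide +kernel
  signedArea_ne_zero := by decide +kernel
  crossing := by decide +kernel
  nodup := by decide +kernel
  common := by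
    simp only [Sym2.mem_iff]
    decide +kernel

theorem isGoodPlacement_K223_deleteEdge_3_6 : IsGoodPlacement
    ![(7, 0), (2, 8), (0, 9), (6, 2), (6, 9), (4, 4), (7, 10)]
    (fun a b => block a ≠ block b ∧ s(a, b) ≠ s(3, 6)) s(1, 6) s(2, 4) s(0, 0) s(3, 3) where
  injective := by decide +kernel
  signedArea_ne_zero := by decide +kernel
  crossing := by decide +kernel
  nodup := by decide +kernel
  common := by
    simp only [Sym2.mem_iff]
    decide +kernel

theorem IsGoodPlacement.nicPlanar_deleteEdges {n m : ℕ} {P : Fin n → ℤ × ℤ}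
    {block : Fin n → Fin m} {x y : Fin n} {e₁ f₁ e₂ f₂ : Sym2 (Fin n)}
    (hP : IsGoodPlacement P (fun a b => block a ≠ block b ∧ s(a, b) ≠ s(x, y)) e₁ f₁ e₂ f₂)
    {V : Type*} {G : SimpleGraph V} {label : V → Fin n} (hlabel : Function.Injective label)
    (hG : ∀ u v, G.Adj u v → block (label u) ≠ block (label v)) (σ : Equiv.Perm (Fin n))
    (hσ : ∀ a b, block a ≠ block b → block (σ a) ≠ block (σ b)) {u v : V}
    (hu : σ (label u) = x) (hv : σ (label v) = y) : (G.deleteEdges {s(u, v)}).NICPlanar := by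
  refine hP.nicPlanar (σ.injective.comp hlabel) fun a b hab => ?_
  rw [SimpleGraph.deleteEdges_adj, Set.mem_singleton_iff] at hab
  refine ⟨hσ _ _ (hG a b hab.1), fun h => hab.2 (Sym2.map.injective (σ.injective.comp hlabel) ?_)⟩
  simpa [hu, hv] using h

theorem nicPlanar_K35_deleteEdges :
    ∀ e ∈ (completeMultipartite ![3, 5]).edgeSet,
      ((completeMultipartite ![3, 5]).deleteEdges {e}).NICPlanar := by
  have hblock : ∀ v, blockK35 (labelK35 v) = v.1 := by decide
  have main : ∀ u v, blockK35 (labelK35 u) = 0 → blockK35 (labelK35 v) = 1 →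
      ((completeMultipartite ![3, 5]).deleteEdges {s(u, v)}).NICPlanar := fun u v hu hv => by
    have hσ : ∀ x y, blockK35 x = 0 → blockK35 y = 1 →
        (∀ a b, blockK35 a ≠ blockK35 b →
          blockK35 ((Equiv.swap x 2 * Equiv.swap y 7) a) ≠
            blockK35 ((Equiv.swap x 2 * Equiv.swap y 7) b)) ∧
        (Equiv.swap x 2 * Equiv.swap y 7) x = 2 ∧ (Equiv.swap x 2 * Equiv.swap y 7) y = 7 := by
      decide +kernel
    obtain ⟨h, hx, hy⟩ := hσ _ _ hu hv
    exact isGoodPlacement_K35.nicPlanar_deleteEdges (by decide : Function.Injective labelK35)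
      (fun a b hab => by simpa [hblock] using hab) _ h hx hy
  intro e he
  induction e with | _ u v
  have huv : blockK35 (labelK35 u) ≠ blockK35 (labelK35 v) := by simpa [hblock] using he
  have cases_two : ∀ x y : Fin 2, x ≠ y → (x = 0 ∧ y = 1) ∨ (y = 0 ∧ x = 1) := by decide
  rcases cases_two _ _ huv with h | h
  · exact main u v h.1 h.2
  · rw [Sym2.eq_swap]
    exact main v u h.1 h.2

/-- The vertices of `K_{2,2,3}` labelled part by part. -/
def labelK223 (v : Σ i : Fin 3, Fin ((![2, 2, 3] : Fin 3 → ℕ) i)) : Fin 7 :=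
  Fin.ofNat 7 (![0, 2, 4] v.1 + v.2.1)

theorem nicPlanar_K223_deleteEdges :
    ∀ e ∈ (completeMultipartite ![2, 2, 3]).edgeSet,
      ((completeMultipartite ![2, 2, 3]).deleteEdges {e}).NICPlanar := by
  have hblock : ∀ v, block (labelK223 v) = v.1 := by decide
  have hinj : Function.Injective labelK223 := by decide
  have hadj : ∀ u v, (completeMultipartite ![2, 2, 3]).Adj u v →
      block (labelK223 u) ≠ block (labelK223 v) := fun u v h => by simpa [hblock] using h
  have two_two : ∀ u v, block (labelK223 u) = 0 → block (labelK223 v) = 1 →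
      ((completeMultipartite ![2, 2, 3]).deleteEdges {s(u, v)}).NICPlanar := fun u v hu hv => by
    have hσ : ∀ x y, block x = 0 → block y = 1 → ∃ σ : Equiv.Perm (Fin 7),
        σ = Equiv.swap x 1 * Equiv.swap y 3 ∧
        (∀ a b, block a ≠ block b → block (σ a) ≠ block (σ b)) ∧ σ x = 1 ∧ σ y = 3 := by
      simp only [exists_eq_left]
      decide +kernel
    obtain ⟨σ, -, h, hx, hy⟩ := hσ _ _ hu hv
    exact isGoodPlacement_K223_deleteEdge_1_3.nicPlanar_deleteEdges hinj hadj σ h hx hy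
  have two_three : ∀ u v, block (labelK223 u) ≠ 2 → block (labelK223 v) = 2 →
      ((completeMultipartite ![2, 2, 3]).deleteEdges {s(u, v)}).NICPlanar := fun u v hu hv => by
    have hσ : ∀ x y, block x ≠ 2 → block y = 2 → ∃ σ : Equiv.Perm (Fin 7),
        (∀ a b, block a ≠ block b → block (σ a) ≠ block (σ b)) ∧ σ x = 3 ∧ σ y = 6 := by
      intro x y hx hy
      by_cases hx1 : block x = 1
      · refine ⟨Equiv.swap x 3 * Equiv.swap y 6, ?_⟩
        decide +kernel +revert
      · refine ⟨Equiv.swap (Equiv.swap 0 2 (Equiv.swap 1 3 x)) 3 * Equiv.swap y 6 *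
          Equiv.swap 0 2 * Equiv.swap 1 3, ?_⟩
        decide +kernel +revert
    obtain ⟨σ, h, hx, hy⟩ := hσ _ _ hu hv
    exact isGoodPlacement_K223_deleteEdge_3_6.nicPlanar_deleteEdges hinj hadj σ h hx hy
  intro e he
  induction e with | _ u v
  have huv := hadj u v he
  have cases_three : ∀ x y : Fin 3, x ≠ y →
      (x = 0 ∧ y = 1) ∨ (y = 0 ∧ x = 1) ∨ (x ≠ 2 ∧ y = 2) ∨ (y ≠ 2 ∧ x = 2) := by decide
  rcases cases_three _ _ huv with h | h | h | h
  · exact two_two u v h.1 h.2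
  · rw [Sym2.eq_swap]
    exact two_two v u h.1 h.2
  · exact two_three u v h.1 h.2
  · rw [Sym2.eq_swap]
    exact two_three v u h.1 h.2

/-- `K_{3,5}` and `K_{2,2,3}` are both minimum non-NIC-planar
graphs. -/
theorem stmt18 :
    MinNonNICPlanar (completeMultipartite ![3, 5]) ∧
    MinNonNICPlanar (completeMultipartite ![2, 2, 3]) :=
  ⟨⟨not_nicPlanar_K35, nicPlanar_K35_deleteEdges⟩,
    not_nicPlanar_K223, nicPlanar_K223_deleteEdges⟩
end
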